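/- arXiv:1601.06928 — 2 statements merged into one kernel-verified Lean document; each statement's English description precedes it below -/
import Mathlib

section
/- Let K be a field, R = K[x_1,...,x_n] the polynomial ring with its standard grading, and let f_1,...,f_n be a homogeneous regular sequence in R of degrees a_1,...,a_n, so that A = R/(f_1,...,f_n) is a graded Artinian complete intersection. Assume the Eisenbud–Green–Harris conjecture holds for A, i.e., for every graded ideal b of R containing (f_1,...,f_n) there exists a graded ideal c of R containing (x_1^{a_1},...,x_n^{a_n}) such that R/b and R/c have the same Hilbert function. Then A has the Sperner property: the maximum of μ(I) over all ideals I of A equals max_i dim_K A_i. -/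
open MvPolynomial Module

/-- The degree-`i` homogeneous component of the standard graded quotient `R/b` of the
polynomial ring `R = K[x_1,…,x_n]` by an ideal `b`: the image of the space of homogeneous
polynomials of degree `i`.  Its dimension is the value `H(R/b, i)` of the Hilbert function. -/
noncomputable def gradedPiece {K : Type*} [Field K] {n : ℕ}
    (b : Ideal (MvPolynomial (Fin n) K)) (i : ℕ) :
    Submodule K (MvPolynomial (Fin n) K ⧸ b) :=
  (homogeneousSubmodule (Fin n) K i).map (Ideal.Quotient.mkₐ K b).toLinearMap

/-- An ideal of the polynomial ring is graded (homogeneous) if it contains all homogeneous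
components of each of its elements. -/
def IsGradedIdeal {K : Type*} [Field K] {n : ℕ} (b : Ideal (MvPolynomial (Fin n) K)) : Prop :=
  ∀ x ∈ b, ∀ i : ℕ, homogeneousComponent i x ∈ b

/-- `μ(I) = dim_K I/mI`, the minimal number of generators of an ideal `I` of a graded algebra
`A` over `K` with graded maximal ideal `m`. -/
noncomputable def nu (K : Type*) {A : Type*} [Field K] [CommRing A] [Algebra K A] (m I : Ideal A) : ℕ :=
  finrank K
    (↥(I.restrictScalars K) ⧸
      (Submodule.comap (I.restrictScalars K).subtype ((m * I).restrictScalars K)))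

/-- The graded maximal ideal `m = ⊕_{i ≥ 1} A_i` of the graded quotient `A = R/b`. -/
noncomputable def gradedMaxIdeal {K : Type*} [Field K] {n : ℕ}
    (b : Ideal (MvPolynomial (Fin n) K)) : Ideal (MvPolynomial (Fin n) K ⧸ b) :=
  Ideal.span {x | ∃ i ≥ 1, x ∈ gradedPiece b i}

section LadderOperators

variable {σ : Type*}

lemma pderiv_comm (i j : σ) (p : MvPolynomial σ ℚ) :
    pderiv i (pderiv j p) = pderiv j (pderiv i p) := by
  classical
  ext m
  simp only [coeff_pderiv, Finsupp.add_apply, Finsupp.single_apply]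
  rw [add_right_comm]
  by_cases h : i = j
  · subst h; rfl
  · simp [h, Ne.symm h]; ring

lemma isHomogeneous_of_mem_restrictSupport {R : Type*} [CommSemiring R] {d : ℕ}
    {S : Set (σ →₀ ℕ)} (hS : ∀ m ∈ S, m.degree = d) {p : MvPolynomial σ R}
    (hp : p ∈ restrictSupport R S) : p.IsHomogeneous d := by
  intro m hm
  rw [← hS m (hp (mem_support_iff.mpr hm)), Finsupp.degree_eq_weight_one, Pi.one_def]

lemma ncard_le_of_injOn {S S' : Set (σ →₀ ℕ)} (hS' : S'.Finite)
    (g : MvPolynomial σ ℚ →ₗ[ℚ] MvPolynomial σ ℚ)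
    (hg : ∀ p ∈ restrictSupport ℚ S, g p ∈ restrictSupport ℚ S')
    (h0 : ∀ p ∈ restrictSupport ℚ S, g p = 0 → p = 0) : S.ncard ≤ S'.ncard := by
  have := hS'.to_subtype
  have : Module.Finite ℚ (restrictSupport ℚ S') := .of_basis (basisRestrictSupport ℚ S')
  have := LinearMap.finrank_le_finrank_of_injective (f := g.restrict hg) (by
    rw [← LinearMap.ker_eq_bot, LinearMap.ker_eq_bot']
    rintro ⟨p, hp⟩ h
    exact Subtype.ext (h0 p hp (congrArg Subtype.val h)))
  rwa [finrank_eq_nat_card_basis (basisRestrictSupport ℚ S),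
    finrank_eq_nat_card_basis (basisRestrictSupport ℚ S')] at this

/-- A vector killed by `e` and by a power of `f` vanishes when its weight `μ` is negative. -/
lemma eq_zero_of_ladder {M : Type*} [AddCommGroup M] [Module ℚ M] (e f : M →ₗ[ℚ] M) {μ : ℚ}
    (hμ : μ < 0) {v : M} (hv : e v = 0)
    (hw : ∀ k : ℕ, e (f ((f ^ k) v)) = f (e ((f ^ k) v)) + (μ - 2 * k) • (f ^ k) v)
    {k : ℕ} (hk : (f ^ k) v = 0) : v = 0 := by
  have hs (k : ℕ) : (f ^ (k + 1)) v = f ((f ^ k) v) := by rw [pow_succ']; rfl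
  have h (k : ℕ) : e ((f ^ (k + 1)) v) = ((k + 1) * (μ - k)) • (f ^ k) v := by
    induction k with
    | zero => rw [hs, hw]; simp [hv]
    | succ k ih =>
      rw [hs, hw, ih, map_smul, ← hs, ← add_smul]
      congr 1
      push_cast; ring
  induction k with
  | zero => simpa using hk
  | succ k ih =>
    refine ih ?_
    have h0 := h k
    rw [hk, map_zero] at h0
    refine (smul_eq_zero.mp h0.symm).resolve_left (mul_ne_zero (by positivity) ?_)
    have : (0 : ℚ) ≤ k := by positivity
    linarith

variable [Fintype σ]

/-- The lowering operator `∑ ∂/∂x_i` of the `sl₂`-action attached to a box of exponents. -/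
noncomputable def lowering (σ : Type*) [Fintype σ] :
    MvPolynomial σ ℚ →ₗ[ℚ] MvPolynomial σ ℚ :=
  ∑ i, (pderiv i).toLinearMap

/-- The raising operator `∑ (b_i x_i - x_i² ∂/∂x_i)` of the `sl₂`-action attached to the box of
exponents bounded by `b`. -/
noncomputable def raising (b : σ → ℕ) : MvPolynomial σ ℚ →ₗ[ℚ] MvPolynomial σ ℚ :=
  ∑ i, ((b i : ℚ) • LinearMap.mulLeft ℚ (X i) -
    LinearMap.mulLeft ℚ (X i ^ 2) ∘ₗ (pderiv i).toLinearMap)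

lemma lowering_apply (p : MvPolynomial σ ℚ) : lowering σ p = ∑ i, pderiv i p := by
  simp [lowering]

lemma raising_apply (b : σ → ℕ) (p : MvPolynomial σ ℚ) :
    raising b p = ∑ i, ((b i : ℚ) • (X i * p) - X i ^ 2 * pderiv i p) := by
  simp [raising]

lemma raising_lowering {b : σ → ℕ} {d : ℕ} {p : MvPolynomial σ ℚ} (hp : p.IsHomogeneous d) :
    raising b (lowering σ p) =
      lowering σ (raising b p) + (2 * d - ∑ i, b i : ℚ) • p := by
  classical
  have key : ∀ i j : σ, pderiv j ((b i : ℚ) • (X i * p) - X i ^ 2 * pderiv i p) =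
      ((b i : ℚ) • (X i * pderiv j p) - X i ^ 2 * pderiv i (pderiv j p)) +
        if i = j then (b i : ℚ) • p - 2 * (X i * pderiv i p) else 0 := by
    intro i j
    rw [pderiv_comm i j p]
    simp only [map_sub, Derivation.map_smul, pderiv_mul, pderiv_pow, pderiv_X]
    by_cases h : i = j
    · subst h; simp [smul_add]; ring
    · simp [h]
  have e : ∑ i, X i * pderiv i p = d • p := hp.sum_X_mul_pderiv
  have h1 : raising b (lowering σ p) =
      ∑ j, ∑ i, ((b i : ℚ) • (X i * pderiv j p) - X i ^ 2 * pderiv i (pderiv j p)) := by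
    rw [lowering_apply, map_sum]
    exact Finset.sum_congr rfl fun j _ => raising_apply b _
  have h2 : lowering σ (raising b p) = raising b (lowering σ p) +
      ∑ i, ((b i : ℚ) • p - 2 * (X i * pderiv i p)) := by
    rw [h1, lowering_apply, raising_apply, Finset.sum_congr rfl fun j _ =>
      (map_sum (pderiv j) _ _).trans (Finset.sum_congr rfl fun i _ => key i j)]
    simp only [Finset.sum_add_distrib, Finset.sum_ite_eq', Finset.mem_univ, if_true]
  rw [h2, add_assoc, Finset.sum_sub_distrib, ← Finset.mul_sum, e, ← Finset.sum_smul]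
  push_cast
  rw [sub_smul, mul_smul, ← Nat.cast_smul_eq_nsmul ℚ, two_mul, two_smul]
  abel

lemma lowering_isHomogeneous {d : ℕ} {p : MvPolynomial σ ℚ} (hp : p.IsHomogeneous d) :
    (lowering σ p).IsHomogeneous (d - 1) := by
  rw [lowering_apply]
  exact IsHomogeneous.sum _ _ _ fun i _ => hp.pderiv

lemma lowering_eq_zero {p : MvPolynomial σ ℚ} (hp : p.IsHomogeneous 0) : lowering σ p = 0 := by
  rw [lowering_apply]
  refine Finset.sum_eq_zero fun i _ => ?_
  rw [totalDegree_eq_zero_iff_eq_C.mp (Nat.le_zero.mp hp.totalDegree_le), pderiv_C]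

/-- The exponent vectors of degree `d` bounded by `b`. -/
def boxLevel (b : σ → ℕ) (d : ℕ) : Set (σ →₀ ℕ) :=
  {m | m.degree = d ∧ ∀ i, m i ≤ b i}

lemma lowering_mem {S S' : Set (σ →₀ ℕ)}
    (h : ∀ m ∈ S, ∀ i, m i ≠ 0 → m - Finsupp.single i 1 ∈ S') {p : MvPolynomial σ ℚ}
    (hp : p ∈ restrictSupport ℚ S) : lowering σ p ∈ restrictSupport ℚ S' := by
  suffices restrictSupport ℚ S ≤ (restrictSupport ℚ S').comap (lowering σ) from this hp
  rw [restrictSupport_eq_span, Submodule.span_le]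
  rintro _ ⟨m, hm, rfl⟩
  simp only [SetLike.mem_coe, Submodule.mem_comap, lowering_apply]
  refine Submodule.sum_mem _ fun i _ => ?_
  rw [pderiv_monomial, monomial_mem_restrictSupport]
  by_cases hi : m i = 0
  · simp [hi]
  · exact Or.inl (h m hm i hi)

lemma raising_mem {b : σ → ℕ} {S S' : Set (σ →₀ ℕ)}
    (h : ∀ m ∈ S, ∀ i, m i ≠ b i → m + Finsupp.single i 1 ∈ S') {p : MvPolynomial σ ℚ}
    (hp : p ∈ restrictSupport ℚ S) : raising b p ∈ restrictSupport ℚ S' := by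
  classical
  suffices restrictSupport ℚ S ≤ (restrictSupport ℚ S').comap (raising b) from this hp
  rw [restrictSupport_eq_span, Submodule.span_le]
  rintro _ ⟨m, hm, rfl⟩
  simp only [SetLike.mem_coe, Submodule.mem_comap, raising_apply]
  refine Submodule.sum_mem _ fun i _ => ?_
  have e : (b i : ℚ) • (X i * monomial m (1 : ℚ)) - X i ^ 2 * pderiv i (monomial m 1) =
      monomial (m + Finsupp.single i 1) ((b i : ℚ) - m i) := by
    rw [pow_two, mul_assoc, X_mul_pderiv_monomial, X, mul_smul_comm, monomial_mul, ← sub_eq_zero,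
      ← Nat.cast_smul_eq_nsmul ℚ, ← sub_smul, smul_monomial]
    simp [add_comm]
  rw [e, monomial_mem_restrictSupport, sub_eq_zero, Nat.cast_inj]
  by_cases hi : m i = b i
  · simp [hi]
  · exact Or.inl (h m hm i hi)

lemma raising_mem_boxLevel {b : σ → ℕ} {d : ℕ} {p : MvPolynomial σ ℚ}
    (hp : p ∈ restrictSupport ℚ (boxLevel b d)) :
    raising b p ∈ restrictSupport ℚ (boxLevel b (d + 1)) := by
  classical
  refine raising_mem (fun m hm i hi => ?_) hp
  refine ⟨by simp [hm.1], fun j => ?_⟩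
  have := hm.2 j
  by_cases hij : i = j
  · subst hij; simp; omega
  · simp [hij, this]

lemma boxLevel_eq_empty {b : σ → ℕ} {d : ℕ} (h : ∑ i, b i < d) : boxLevel b d = ∅ := by
  refine Set.eq_empty_of_forall_notMem fun m hm => ?_
  have : m.degree ≤ ∑ i, b i := by
    rw [Finsupp.degree_eq_sum]; exact Finset.sum_le_sum fun i _ => hm.2 i
  have := hm.1
  omega

lemma finite_boxLevel (b : σ → ℕ) (d : ℕ) : (boxLevel b d).Finite :=
  (Finsupp.finite_of_degree_eq d).subset fun _ hm => hm.1

lemma raising_injective {b : σ → ℕ} {d : ℕ} (hd : 2 * d < ∑ i, b i) {p : MvPolynomial σ ℚ}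
    (hp : p.IsHomogeneous d) (h : raising b p = 0) : p = 0 := by
  have hk (k : ℕ) : (((lowering σ) ^ k) p).IsHomogeneous (d - k) := by
    induction k with
    | zero => simpa using hp
    | succ k ih =>
      rw [pow_succ', Module.End.mul_apply, ← Nat.sub_sub]
      exact lowering_isHomogeneous ih
  have hz : ((lowering σ) ^ (d + 1)) p = 0 := by
    rw [pow_succ', Module.End.mul_apply]
    exact lowering_eq_zero (by simpa using hk d)
  have hlt : (2 * d - ∑ i, b i : ℚ) < 0 := by
    rw [sub_neg]; exact_mod_cast hd
  refine eq_zero_of_ladder (raising b) (lowering σ) hlt h (fun k => ?_) hz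
  by_cases hkd : k ≤ d
  · rw [raising_lowering (hk k), Nat.cast_sub hkd]
    congr 2; push_cast; ring
  · have : ((lowering σ) ^ k) p = 0 := by
      obtain ⟨j, rfl⟩ : ∃ j, k = j + (d + 1) := ⟨k - (d + 1), by omega⟩
      rw [pow_add, Module.End.mul_apply, hz, map_zero]
    simp [this]

lemma lowering_injective {b : σ → ℕ} {d : ℕ} (hd : ∑ i, b i < 2 * d) {p : MvPolynomial σ ℚ}
    (hp : p ∈ restrictSupport ℚ (boxLevel b d)) (h : lowering σ p = 0) : p = 0 := by
  have hk (k : ℕ) : ((raising b) ^ k) p ∈ restrictSupport ℚ (boxLevel b (d + k)) := by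
    induction k with
    | zero => simpa using hp
    | succ k ih =>
      rw [pow_succ', Module.End.mul_apply, ← add_assoc]
      exact raising_mem_boxLevel ih
  have hz : ((raising b) ^ (∑ i, b i + 1)) p = 0 := by
    have := hk (∑ i, b i + 1)
    rw [boxLevel_eq_empty (by omega)] at this
    simpa [mem_restrictSupport_iff] using this
  have hlt : (∑ i, b i - 2 * d : ℚ) < 0 := by
    rw [sub_neg]; exact_mod_cast hd
  refine eq_zero_of_ladder (lowering σ) (raising b) hlt h (fun k => ?_) hz
  rw [raising_lowering (isHomogeneous_of_mem_restrictSupport (fun _ hm => hm.1) (hk k)), add_assoc,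
    ← add_smul]
  push_cast
  ring_nf
  simp

lemma ncard_le_ncard_of_up {b : σ → ℕ} {d : ℕ} (hd : 2 * d < ∑ i, b i) {S S' : Set (σ →₀ ℕ)}
    (hS : S ⊆ boxLevel b d) (hS' : S' ⊆ boxLevel b (d + 1))
    (h : ∀ m ∈ S, ∀ i, m i ≠ b i → m + Finsupp.single i 1 ∈ S') : S.ncard ≤ S'.ncard :=
  ncard_le_of_injOn ((finite_boxLevel b _).subset hS') (raising b)
    (fun _ hp => raising_mem h hp) fun _ hp h0 =>
      raising_injective hd (isHomogeneous_of_mem_restrictSupport (fun _ hm => (hS hm).1) hp) h0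

lemma ncard_le_ncard_of_down {b : σ → ℕ} {d : ℕ} (hd : ∑ i, b i < 2 * (d + 1))
    {T T' : Set (σ →₀ ℕ)} (hT : T ⊆ boxLevel b d) (hT' : T' ⊆ boxLevel b (d + 1))
    (h : ∀ m ∈ T', ∀ i, m i ≠ 0 → m - Finsupp.single i 1 ∈ T) : T'.ncard ≤ T.ncard :=
  ncard_le_of_injOn ((finite_boxLevel b _).subset hT) (lowering σ)
    (fun _ hp => lowering_mem h hp) fun _ hp h0 =>
      lowering_injective hd (restrictSupport_mono _ hT' hp) h0

end LadderOperators

section StandardMonomials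

variable {K : Type*} [Field K] {n : ℕ}

/-- The exponent vectors of degree `d` that are not lexicographic leading exponents of elements
of `c`. -/
def standardExponents (c : Ideal (MvPolynomial (Fin n) K)) (d : ℕ) : Set (Fin n →₀ ℕ) :=
  {m | m.degree = d ∧ ∀ p ∈ c, p ≠ 0 → MonomialOrder.lex.degree p ≠ m}

lemma monomial_mem_map_standardExponents {c : Ideal (MvPolynomial (Fin n) K)}
    (hc : IsGradedIdeal c) {d : ℕ} {m : Fin n →₀ ℕ} (hm : m.degree = d) :
    Ideal.Quotient.mkₐ K c (monomial m 1) ∈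
      (restrictSupport K (standardExponents c d)).map (Ideal.Quotient.mkₐ K c).toLinearMap := by
  classical
  induction hs : (MonomialOrder.lex.toSyn m) using WellFoundedLT.induction generalizing m with
  | ind s ih =>
  by_cases hT : m ∈ standardExponents c d
  · exact ⟨_, (monomial_mem_restrictSupport K).mpr (Or.inl hT), rfl⟩
  obtain ⟨p, hp, hp0, hpm⟩ : ∃ p ∈ c, p ≠ 0 ∧ MonomialOrder.lex.degree p = m := by
    simpa [standardExponents, hm] using hT
  set q := homogeneousComponent d p
  have hqm : q.coeff m = p.coeff m := by rw [coeff_homogeneousComponent, if_pos hm]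
  have hl : q.coeff m ≠ 0 := by
    rw [hqm, ← hpm, MonomialOrder.coeff_degree_ne_zero_iff]; exact hp0
  set r := q - monomial m (q.coeff m) with hr
  have hrs : ∀ s ∈ r.support, s.degree = d ∧
      MonomialOrder.lex.toSyn s < MonomialOrder.lex.toSyn m := by
    intro s hs
    have hsm : s ≠ m := by
      rintro rfl
      simp [hr] at hs
    have hsq : q.coeff s ≠ 0 := by
      simpa [hr, coeff_monomial, hsm.symm] using hs
    rw [coeff_homogeneousComponent] at hsq
    obtain ⟨h1, h2⟩ : s.degree = d ∧ p.coeff s ≠ 0 := by simpa using hsq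
    refine ⟨h1, lt_of_le_of_ne ?_ ?_⟩
    · rw [← hpm]
      exact MonomialOrder.lex.le_degree (mem_support_iff.mpr h2)
    · simpa using hsm
  have hrm : Ideal.Quotient.mkₐ K c r ∈
      (restrictSupport K (standardExponents c d)).map (Ideal.Quotient.mkₐ K c).toLinearMap := by
    rw [r.as_sum, map_sum]
    refine Submodule.sum_mem _ fun s hs' => ?_
    rw [← mul_one (coeff s r), ← smul_eq_mul, ← smul_monomial, map_smul]
    refine Submodule.smul_mem _ _ (ih _ ?_ (hrs s hs').1 rfl)
    rw [← hs]
    exact (hrs s hs').2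
  have hq0 : Ideal.Quotient.mkₐ K c q = 0 := Ideal.Quotient.eq_zero_iff_mem.mpr (hc p hp d)
  have : Ideal.Quotient.mkₐ K c (monomial m 1) =
      -((q.coeff m)⁻¹ • Ideal.Quotient.mkₐ K c r) := by
    rw [hr, map_sub, hq0, zero_sub, smul_neg, neg_neg, ← map_smul, smul_monomial, smul_eq_mul,
      inv_mul_cancel₀ hl]
  rw [this]
  exact Submodule.neg_mem _ (Submodule.smul_mem _ _ hrm)

lemma map_restrictSupport_standardExponents {c : Ideal (MvPolynomial (Fin n) K)}
    (hc : IsGradedIdeal c) (d : ℕ) :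
    (restrictSupport K (standardExponents c d)).map (Ideal.Quotient.mkₐ K c).toLinearMap =
      gradedPiece c d := by
  refine le_antisymm (Submodule.map_mono fun p hp =>
    isHomogeneous_of_mem_restrictSupport (fun _ hm => hm.1) hp) ?_
  rintro _ ⟨p, hp, rfl⟩
  change Ideal.Quotient.mkₐ K c p ∈ _
  rw [p.as_sum, map_sum]
  refine Submodule.sum_mem _ fun s hs => ?_
  rw [← mul_one (coeff s p), ← smul_eq_mul, ← smul_monomial, map_smul]
  refine Submodule.smul_mem _ _ (monomial_mem_map_standardExponents hc ?_)
  have := hp (mem_support_iff.mp hs)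
  rwa [Finsupp.degree_eq_weight_one]

/-- Macaulay's theorem: standard monomials compute the Hilbert function. -/
lemma finrank_gradedPiece_eq_ncard {c : Ideal (MvPolynomial (Fin n) K)}
    (hc : IsGradedIdeal c) (d : ℕ) :
    finrank K (gradedPiece c d) = (standardExponents c d).ncard := by
  rw [← map_restrictSupport_standardExponents hc]
  set f := (Ideal.Quotient.mkₐ K c).toLinearMap.domRestrict
    (restrictSupport K (standardExponents c d)) with hf
  have hinj : Function.Injective f := by
    rw [← LinearMap.ker_eq_bot, LinearMap.ker_eq_bot']
    rintro ⟨p, hp⟩ h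
    have hpc : p ∈ c := Ideal.Quotient.eq_zero_iff_mem.mp h
    by_contra h0
    have hp0 : p ≠ 0 := fun e => h0 (Subtype.ext e)
    exact (hp (MonomialOrder.lex.degree_mem_support hp0)).2 p hpc hp0 rfl
  rw [← LinearMap.range_domRestrict, LinearMap.finrank_range_of_inj hinj,
    finrank_eq_nat_card_basis (basisRestrictSupport K (standardExponents c d))]
  rfl

lemma sub_single_mem_standardExponents {c : Ideal (MvPolynomial (Fin n) K)} {d : ℕ}
    {m : Fin n →₀ ℕ} (hm : m ∈ standardExponents c (d + 1)) {i : Fin n} (hi : m i ≠ 0) :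
    m - Finsupp.single i 1 ∈ standardExponents c d := by
  have hle : Finsupp.single i 1 ≤ m := by
    rw [Finsupp.single_le_iff]; omega
  have e : Finsupp.single i 1 + (m - Finsupp.single i 1) = m := add_tsub_cancel_of_le hle
  refine ⟨?_, fun p hp hp0 hpm => hm.2 (X i * p) (c.mul_mem_left _ hp)
    (mul_ne_zero (X_ne_zero i) hp0) ?_⟩
  · have := congrArg Finsupp.degree e
    rw [map_add, Finsupp.degree_single, hm.1] at this
    omega
  · rw [MonomialOrder.degree_mul (X_ne_zero i) hp0, MonomialOrder.degree_X, hpm, e]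

lemma standardExponents_subset_boxLevel {c : Ideal (MvPolynomial (Fin n) K)} {a : Fin n → ℕ}
    (ha : ∀ i, (X i : MvPolynomial (Fin n) K) ^ a i ∈ c) (d : ℕ) :
    standardExponents c d ⊆ boxLevel (fun i => a i - 1) d := by
  classical
  refine fun m hm => ⟨hm.1, fun i => ?_⟩
  by_contra h
  simp only [not_le] at h
  have hle : Finsupp.single i (a i) ≤ m := by
    rw [Finsupp.single_le_iff]; omega
  refine hm.2 (monomial m 1) ?_ (by simp) (by simp [MonomialOrder.degree_monomial])
  rw [← add_tsub_cancel_of_le hle, ← one_mul (1 : K), ← monomial_mul, ← X_pow_eq_monomial]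
  exact c.mul_mem_right _ (ha i)

lemma ncard_boxLevel_add_le {c : Ideal (MvPolynomial (Fin n) K)} (hc : IsGradedIdeal c)
    {a : Fin n → ℕ} (ha : ∀ i, (X i : MvPolynomial (Fin n) K) ^ a i ∈ c) {d : ℕ}
    (hd : 2 * d < ∑ i, (a i - 1)) :
    (boxLevel (fun i => a i - 1) d).ncard + finrank K (gradedPiece c (d + 1)) ≤
      (boxLevel (fun i => a i - 1) (d + 1)).ncard + finrank K (gradedPiece c d) := by
  classical
  have hs := standardExponents_subset_boxLevel ha
  have h := ncard_le_ncard_of_up hd (S := boxLevel _ d \ standardExponents c d)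
    (S' := boxLevel _ (d + 1) \ standardExponents c (d + 1)) Set.sdiff_subset Set.sdiff_subset ?_
  · rw [finrank_gradedPiece_eq_ncard hc, finrank_gradedPiece_eq_ncard hc,
      ← Set.ncard_sdiff_add_ncard_of_subset (hs d) (finite_boxLevel _ _),
      ← Set.ncard_sdiff_add_ncard_of_subset (hs (d + 1)) (finite_boxLevel _ _)]
    omega
  · rintro m ⟨hm, hmT⟩ i hi
    refine ⟨⟨by simp [hm.1], fun j => ?_⟩, fun h => hmT ?_⟩
    · have : m j ≤ a j - 1 := hm.2 j
      by_cases hij : i = j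
      · subst hij; simp; omega
      · simp [hij, this]
    · simpa using sub_single_mem_standardExponents h (i := i) (by simp)

lemma finrank_gradedPiece_succ_le {c : Ideal (MvPolynomial (Fin n) K)} (hc : IsGradedIdeal c)
    {a : Fin n → ℕ} (ha : ∀ i, (X i : MvPolynomial (Fin n) K) ^ a i ∈ c) {d : ℕ}
    (hd : ∑ i, (a i - 1) < 2 * (d + 1)) :
    finrank K (gradedPiece c (d + 1)) ≤ finrank K (gradedPiece c d) := by
  rw [finrank_gradedPiece_eq_ncard hc, finrank_gradedPiece_eq_ncard hc]
  exact ncard_le_ncard_of_down hd (standardExponents_subset_boxLevel ha d)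
    (standardExponents_subset_boxLevel ha (d + 1))
    fun _ hm _ hi => sub_single_mem_standardExponents hm hi

end StandardMonomials

section GradedQuotient

variable {K : Type*} [Field K] {n : ℕ}

lemma finrank_map_add_finrank_inf_ker {V W : Type*} [AddCommGroup V] [Module K V]
    [AddCommGroup W] [Module K W] (f : V →ₗ[K] W) (p : Submodule K V) [Module.Finite K p] :
    finrank K (p.map f) + finrank K (p ⊓ LinearMap.ker f : Submodule K V) = finrank K p := by
  rw [← LinearMap.finrank_range_add_finrank_ker (f.domRestrict p), LinearMap.range_domRestrict,
    LinearMap.ker_domRestrict, ← Submodule.finrank_map_subtype_eq p, Submodule.map_comap_subtype]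

lemma homogeneousComponent_add_mul {f : MvPolynomial (Fin n) K} {a : ℕ} (hf : f.IsHomogeneous a)
    (p : MvPolynomial (Fin n) K) (j : ℕ) :
    homogeneousComponent (a + j) (f * p) = f * homogeneousComponent j p := by
  let _ := MvPolynomial.gradedAlgebra (σ := Fin n) (R := K)
  have := DirectSum.coe_decompose_mul_add_of_left_mem (homogeneousSubmodule (Fin n) K) (j := j)
    (b := p) hf
  rwa [← decomposition.decompose'_apply, ← decomposition.decompose'_apply]

lemma homogeneousComponent_mul_of_lt {f : MvPolynomial (Fin n) K} {a : ℕ}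
    (hf : f.IsHomogeneous a) (p : MvPolynomial (Fin n) K) {j : ℕ} (hj : j < a) :
    homogeneousComponent j (f * p) = 0 := by
  let _ := MvPolynomial.gradedAlgebra (σ := Fin n) (R := K)
  have := DirectSum.coe_decompose_mul_of_left_mem_of_not_le (homogeneousSubmodule (Fin n) K)
    (b := p) hf hj.not_ge
  rwa [← decomposition.decompose'_apply]

lemma isGradedIdeal_bot : IsGradedIdeal (⊥ : Ideal (MvPolynomial (Fin n) K)) := by
  rintro x rfl i
  simp

lemma IsGradedIdeal.sup {I J : Ideal (MvPolynomial (Fin n) K)} (hI : IsGradedIdeal I)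
    (hJ : IsGradedIdeal J) : IsGradedIdeal (I ⊔ J) := by
  intro x hx i
  obtain ⟨y, hy, z, hz, rfl⟩ := Submodule.mem_sup.mp hx
  rw [map_add]
  exact add_mem (Ideal.mem_sup_left (hI y hy i)) (Ideal.mem_sup_right (hJ z hz i))

lemma isGradedIdeal_span_singleton {f : MvPolynomial (Fin n) K} {a : ℕ}
    (hf : f.IsHomogeneous a) : IsGradedIdeal (Ideal.span {f}) := by
  intro x hx i
  obtain ⟨y, rfl⟩ := Ideal.mem_span_singleton'.mp hx
  rw [mul_comm]
  by_cases h : a ≤ i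
  · obtain ⟨j, rfl⟩ := Nat.exists_eq_add_of_le h
    rw [homogeneousComponent_add_mul hf]
    exact Ideal.mul_mem_right _ _ (Ideal.mem_span_singleton_self f)
  · rw [homogeneousComponent_mul_of_lt hf _ (not_le.mp h)]
    exact zero_mem _

instance finite_homogeneousSubmodule (d : ℕ) :
    Module.Finite K (homogeneousSubmodule (Fin n) K d) := by
  have := (Finsupp.finite_of_degree_eq (σ := Fin n) d).to_subtype
  have : Module.Finite K (restrictSupport K {m : Fin n →₀ ℕ | m.degree = d}) :=
    .of_basis (basisRestrictSupport K _)
  have h : homogeneousSubmodule (Fin n) K d ≤ restrictSupport K {m | m.degree = d} := by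
    intro p hp m hm
    have := hp (mem_support_iff.mp hm)
    rwa [Set.mem_ofPred_eq, Finsupp.degree_eq_weight_one]
  exact Submodule.finiteDimensional_of_le h

instance finite_gradedPiece (b : Ideal (MvPolynomial (Fin n) K)) (d : ℕ) :
    Module.Finite K (gradedPiece b d) := by
  unfold gradedPiece
  infer_instance

lemma mk_mem_gradedPiece (b : Ideal (MvPolynomial (Fin n) K)) {d : ℕ}
    {p : MvPolynomial (Fin n) K} (hp : p.IsHomogeneous d) :
    Ideal.Quotient.mk b p ∈ gradedPiece b d := ⟨p, hp, rfl⟩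

lemma map_factor_gradedPiece {J b : Ideal (MvPolynomial (Fin n) K)} (h : J ≤ b) (d : ℕ) :
    (gradedPiece J d).map (Ideal.Quotient.factorₐ K h).toLinearMap = gradedPiece b d := by
  rw [gradedPiece, gradedPiece, ← Submodule.map_comp]
  rfl

/-- The recursion satisfied by the Hilbert function of a quotient by a homogeneous nonzerodivisor
of degree `a`. -/
lemma finrank_gradedPiece_sup_span_singleton {J : Ideal (MvPolynomial (Fin n) K)}
    (hJ : IsGradedIdeal J) {f : MvPolynomial (Fin n) K} {a : ℕ} (hf : f.IsHomogeneous a)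
    (hreg : ∀ x, f * x ∈ J → x ∈ J) (d : ℕ) :
    finrank K (gradedPiece (J ⊔ Ideal.span {f}) d) +
      (if a ≤ d then finrank K (gradedPiece J (d - a)) else 0) = finrank K (gradedPiece J d) := by
  have hle : J ≤ J ⊔ Ideal.span {f} := le_sup_left
  rw [← finrank_map_add_finrank_inf_ker (Ideal.Quotient.factorₐ K hle).toLinearMap
    (gradedPiece J d), map_factor_gradedPiece]
  congr 1
  have hker {y} (hy : y ∈ gradedPiece J d ⊓
      LinearMap.ker (Ideal.Quotient.factorₐ K hle).toLinearMap) :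
      ∃ z, y = Ideal.Quotient.mk J (homogeneousComponent d (f * z)) := by
    obtain ⟨⟨x, hx, rfl⟩, hx'⟩ := hy
    have hxm : x ∈ J ⊔ Ideal.span {f} := Ideal.Quotient.eq_zero_iff_mem.mp hx'
    rw [sup_comm, Ideal.mem_span_singleton_sup] at hxm
    obtain ⟨z, j, hj, rfl⟩ := hxm
    refine ⟨z, ?_⟩
    rw [← homogeneousComponent_eq_self hx, map_add, mul_comm z f]
    change Ideal.Quotient.mk J _ = _
    rw [map_add, Ideal.Quotient.eq_zero_iff_mem.mpr (hJ j hj d), add_zero]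
  split_ifs with had
  · obtain ⟨e, rfl⟩ := Nat.exists_eq_add_of_le had
    rw [Nat.add_sub_cancel_left]
    have hinj : Function.Injective (LinearMap.mulLeft K (Ideal.Quotient.mk J f)) := by
      rw [← LinearMap.ker_eq_bot, LinearMap.ker_eq_bot']
      intro y hy
      obtain ⟨x, rfl⟩ := Ideal.Quotient.mk_surjective y
      rw [LinearMap.mulLeft_apply, ← map_mul, Ideal.Quotient.eq_zero_iff_mem] at hy
      exact Ideal.Quotient.eq_zero_iff_mem.mpr (hreg x hy)
    rw [(Submodule.equivMapOfInjective _ hinj (gradedPiece J e)).finrank_eq]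
    suffices h : (gradedPiece J e).map (LinearMap.mulLeft K (Ideal.Quotient.mk J f)) =
        gradedPiece J (a + e) ⊓ LinearMap.ker (Ideal.Quotient.factorₐ K hle).toLinearMap by
      rw [h]
    refine le_antisymm ?_ fun y hy => ?_
    · rintro _ ⟨_, ⟨x, hx, rfl⟩, rfl⟩
      refine ⟨⟨f * x, hf.mul hx, map_mul (Ideal.Quotient.mk J) f x⟩, ?_⟩
      refine Ideal.Quotient.eq_zero_iff_mem.mpr (Ideal.mem_sup_right ?_ : f * x ∈ _)
      exact Ideal.mul_mem_right _ _ (Ideal.mem_span_singleton_self f)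
    · obtain ⟨z, rfl⟩ := hker hy
      rw [homogeneousComponent_add_mul hf, map_mul]
      exact ⟨_, mk_mem_gradedPiece J (homogeneousComponent_isHomogeneous e z), rfl⟩
  · symm
    refine Submodule.finrank_eq_zero.mpr ?_
    rw [Submodule.eq_bot_iff]
    intro y hy
    obtain ⟨z, rfl⟩ := hker hy
    rw [homogeneousComponent_mul_of_lt hf _ (not_le.mp had), map_zero]

/-- The exponent vectors of degree `d` with the first `k` exponents strictly bounded by `a`. -/
def partialBox (a : Fin n → ℕ) (k d : ℕ) : Set (Fin n →₀ ℕ) :=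
  {m | m.degree = d ∧ ∀ i : Fin n, i.val < k → m i < a i}

lemma finite_partialBox (a : Fin n → ℕ) (k d : ℕ) : (partialBox a k d).Finite :=
  (Finsupp.finite_of_degree_eq d).subset fun _ hm => hm.1

lemma ncard_partialBox_succ (a : Fin n → ℕ) (k : Fin n) (d : ℕ) :
    (partialBox a (k + 1) d).ncard +
      (if a k ≤ d then (partialBox a k (d - a k)).ncard else 0) = (partialBox a k d).ncard := by
  classical
  have hsub : partialBox a (k + 1) d ⊆ partialBox a k d :=
    fun m hm => ⟨hm.1, fun i hi => hm.2 i (by omega)⟩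
  rw [← Set.ncard_sdiff_add_ncard_of_subset hsub (finite_partialBox a k d), add_comm]
  congr 1
  have hge {m} (hm : m ∈ partialBox a k d \ partialBox a (k + 1) d) : a k ≤ m k := by
    by_contra h
    refine hm.2 ⟨hm.1.1, fun i hi => ?_⟩
    rcases Nat.lt_succ_iff_lt_or_eq.mp hi with h' | h'
    · exact hm.1.2 i h'
    · rw [Fin.ext h']; omega
  split_ifs with had
  · rw [← Set.ncard_image_of_injective _ (add_right_injective (Finsupp.single k (a k)))]
    congr 1
    ext m
    constructor
    · rintro ⟨m, hm, rfl⟩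
      refine ⟨⟨?_, fun i hi => ?_⟩, fun h => ?_⟩
      · have := hm.1
        simp only [map_add, Finsupp.degree_single]
        omega
      · have hik : k ≠ i := fun h => by subst h; omega
        simpa [hik] using hm.2 i hi
      · have := h.2 k (by omega)
        simp at this
    · intro hm
      have hle : Finsupp.single k (a k) ≤ m := by
        rw [Finsupp.single_le_iff]; exact hge hm
      have e := add_tsub_cancel_of_le hle
      refine ⟨m - Finsupp.single k (a k), ⟨?_, fun i hi => ?_⟩, e⟩
      · have h1 := congrArg Finsupp.degree e
        rw [map_add, Finsupp.degree_single, hm.1.1] at h1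
        omega
      · have := hm.1.2 i hi
        rw [Finsupp.tsub_apply]
        omega
  · symm
    convert Set.ncard_empty (Fin n →₀ ℕ)
    refine Set.eq_empty_of_forall_notMem fun m hm => had ?_
    rw [← hm.1.1]
    exact (hge hm).trans (Finsupp.le_degree k m)

lemma standardExponents_bot (a : Fin n → ℕ) (d : ℕ) :
    standardExponents (⊥ : Ideal (MvPolynomial (Fin n) K)) d = partialBox a 0 d := by
  ext m
  simp [standardExponents, partialBox]

lemma finrank_gradedPiece_take {f : Fin n → MvPolynomial (Fin n) K} {a : Fin n → ℕ}
    (hhom : ∀ i, (f i).IsHomogeneous (a i))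
    (hreg : RingTheory.Sequence.IsRegular (MvPolynomial (Fin n) K) (List.ofFn f)) {k : ℕ}
    (hk : k ≤ n) :
    IsGradedIdeal (Ideal.ofList ((List.ofFn f).take k)) ∧ ∀ d,
      finrank K (gradedPiece (Ideal.ofList ((List.ofFn f).take k)) d) =
        (partialBox a k d).ncard := by
  induction k with
  | zero =>
    have e : Ideal.ofList ((List.ofFn f).take 0) = ⊥ := by
      rw [List.take_zero, Ideal.ofList_nil]
    rw [e]
    exact ⟨isGradedIdeal_bot, fun d => by
      rw [finrank_gradedPiece_eq_ncard isGradedIdeal_bot, standardExponents_bot a]⟩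
  | succ k ih =>
    obtain ⟨hg, hd⟩ := ih (by omega)
    have hlen : k < (List.ofFn f).length := by simpa using hk
    have e : Ideal.ofList ((List.ofFn f).take (k + 1)) =
        Ideal.ofList ((List.ofFn f).take k) ⊔ Ideal.span {f ⟨k, hk⟩} := by
      rw [← List.take_concat_get' _ _ hlen, Ideal.ofList_append, Ideal.ofList_singleton]
      simp
    have hr : ∀ x, f ⟨k, hk⟩ * x ∈ Ideal.ofList ((List.ofFn f).take k) →
        x ∈ Ideal.ofList ((List.ofFn f).take k) := by
      have := hreg.regular_mod_prev k hlen
      rw [isSMulRegular_quotient_iff_mem_of_smul_mem] at this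
      simpa using this
    rw [e]
    refine ⟨hg.sup (isGradedIdeal_span_singleton (hhom _)), fun d => ?_⟩
    have h1 := finrank_gradedPiece_sup_span_singleton hg (hhom ⟨k, hk⟩) hr d
    have h2 := ncard_partialBox_succ a ⟨k, hk⟩ d
    simp only [hd] at h1
    simp only at h2
    omega

lemma ofList_ofFn (f : Fin n → MvPolynomial (Fin n) K) :
    Ideal.ofList ((List.ofFn f).take n) = Ideal.span (Set.range f) := by
  rw [List.take_of_length_le (by simp), Ideal.ofList]
  congr 1
  ext x
  simp [List.mem_ofFn]

lemma isGradedIdeal_span_range {f : Fin n → MvPolynomial (Fin n) K} {a : Fin n → ℕ}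
    (hhom : ∀ i, (f i).IsHomogeneous (a i))
    (hreg : RingTheory.Sequence.IsRegular (MvPolynomial (Fin n) K) (List.ofFn f)) :
    IsGradedIdeal (Ideal.span (Set.range f)) :=
  ofList_ofFn f ▸ (finrank_gradedPiece_take hhom hreg le_rfl).1

/-- The Hilbert function of a graded complete intersection counts the monomials in a box. -/
lemma finrank_gradedPiece_span_range {f : Fin n → MvPolynomial (Fin n) K} {a : Fin n → ℕ}
    (hpos : ∀ i, 0 < a i) (hhom : ∀ i, (f i).IsHomogeneous (a i))
    (hreg : RingTheory.Sequence.IsRegular (MvPolynomial (Fin n) K) (List.ofFn f)) (d : ℕ) :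
    finrank K (gradedPiece (Ideal.span (Set.range f)) d) =
      (boxLevel (fun i => a i - 1) d).ncard := by
  rw [← ofList_ofFn f, (finrank_gradedPiece_take hhom hreg le_rfl).2]
  congr 1
  ext m
  refine and_congr_right fun _ => forall_congr' fun i => ?_
  have := hpos i
  simp only [i.isLt, true_imp_iff]
  omega

end GradedQuotient

section AssociatedGraded

variable {K : Type*} [Field K] {n : ℕ}

lemma homogeneousComponent_homogeneousComponent (i j : ℕ) (p : MvPolynomial (Fin n) K) :
    homogeneousComponent i (homogeneousComponent j p) =
      if i = j then homogeneousComponent j p else 0 :=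
  homogeneousComponent_of_mem (homogeneousComponent_isHomogeneous j p)

/-- Prescribing subspaces `V ⊆ A_d` and `W ⊆ A_{d+1}` with `A_1 V ⊆ W` defines a graded ideal
whose quotient has `A_d / V` and `A_{d+1} / W` as its components of degrees `d` and `d + 1`. -/
lemma exists_gradedIdeal {J : Ideal (MvPolynomial (Fin n) K)} (hJ : IsGradedIdeal J) {d : ℕ}
    {V W : Submodule K (MvPolynomial (Fin n) K ⧸ J)} (hV : V ≤ gradedPiece J d)
    (hW : W ≤ gradedPiece J (d + 1)) (hVW : ∀ v ∈ V, ∀ i, Ideal.Quotient.mk J (X i) * v ∈ W) :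
    ∃ b : Ideal (MvPolynomial (Fin n) K), IsGradedIdeal b ∧ J ≤ b ∧
      finrank K (gradedPiece b d) + finrank K V = finrank K (gradedPiece J d) ∧
      finrank K (gradedPiece b (d + 1)) + finrank K W = finrank K (gradedPiece J (d + 1)) := by
  let P : MvPolynomial (Fin n) K → Prop := fun x => (∀ j < d, homogeneousComponent j x ∈ J) ∧
    Ideal.Quotient.mkₐ K J (homogeneousComponent d x) ∈ V ∧
    Ideal.Quotient.mkₐ K J (homogeneousComponent (d + 1) x) ∈ W
  have hadd : ∀ x y, P x → P y → P (x + y) := by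
    intro x y hx hy
    refine ⟨fun j hj => ?_, ?_, ?_⟩ <;> simp only [map_add]
    · exact add_mem (hx.1 j hj) (hy.1 j hj)
    · exact add_mem hx.2.1 hy.2.1
    · exact add_mem hx.2.2 hy.2.2
  have hX : ∀ x i, P x → P (X i * x) := by
    intro x i hx
    have hs (j : ℕ) : homogeneousComponent (j + 1) (X i * x) = X i * homogeneousComponent j x := by
      rw [add_comm, homogeneousComponent_add_mul (isHomogeneous_X K i)]
    have h0 : homogeneousComponent 0 (X i * x) = 0 :=
      homogeneousComponent_mul_of_lt (isHomogeneous_X K i) x one_pos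
    refine ⟨fun j hj => ?_, ?_, ?_⟩
    · cases j with
      | zero => rw [h0]; exact zero_mem _
      | succ j => rw [hs]; exact J.mul_mem_left _ (hx.1 j (by omega))
    · cases d with
      | zero => rw [h0, map_zero]; exact zero_mem _
      | succ d =>
        rw [hs]
        convert zero_mem V
        exact Ideal.Quotient.eq_zero_iff_mem.mpr (J.mul_mem_left _ (hx.1 d (by omega)))
    · rw [hs, map_mul]
      exact hVW _ hx.2.1 i
  have hsmul : ∀ r x, P x → P (r * x) := by
    intro r
    induction r using MvPolynomial.induction_on with
    | C c =>
      intro x hx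
      refine ⟨fun j hj => ?_, ?_, ?_⟩ <;> rw [homogeneousComponent_C_mul]
      · exact J.mul_mem_left _ (hx.1 j hj)
      · rw [← smul_eq_C_mul, map_smul]; exact V.smul_mem _ hx.2.1
      · rw [← smul_eq_C_mul, map_smul]; exact W.smul_mem _ hx.2.2
    | add p q hp hq => exact fun x hx => add_mul p q x ▸ hadd _ _ (hp x hx) (hq x hx)
    | mul_X p i hp => exact fun x hx => mul_assoc p (X i) x ▸ hp _ (hX x i hx)
  let b : Ideal (MvPolynomial (Fin n) K) :=
    { carrier := {x | P x}
      add_mem' := fun {x y} hx hy => hadd x y hx hy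
      zero_mem' := ⟨by simp, by simp, by simp⟩
      smul_mem' := fun r x hx => hsmul r x hx }
  have hb {x} : x ∈ b ↔ P x := Iff.rfl
  have hJb : J ≤ b := by
    refine fun x hx => hb.mpr ⟨fun j _ => hJ x hx j, ?_, ?_⟩
    · convert zero_mem V
      exact Ideal.Quotient.eq_zero_iff_mem.mpr (hJ x hx d)
    · convert zero_mem W
      exact Ideal.Quotient.eq_zero_iff_mem.mpr (hJ x hx (d + 1))
  have hrank {e : ℕ} {U : Submodule K (MvPolynomial (Fin n) K ⧸ J)} (hU : U ≤ gradedPiece J e)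
      (h : ∀ x : MvPolynomial (Fin n) K, x.IsHomogeneous e →
        (x ∈ b ↔ Ideal.Quotient.mkₐ K J x ∈ U)) :
      finrank K (gradedPiece b e) + finrank K U = finrank K (gradedPiece J e) := by
    rw [← finrank_map_add_finrank_inf_ker (Ideal.Quotient.factorₐ K hJb).toLinearMap
      (gradedPiece J e), map_factor_gradedPiece]
    suffices h : gradedPiece J e ⊓ LinearMap.ker (Ideal.Quotient.factorₐ K hJb).toLinearMap = U by
      rw [h]
    ext y
    constructor
    · rintro ⟨⟨x, hx, rfl⟩, hy⟩
      exact (h x hx).mp (Ideal.Quotient.eq_zero_iff_mem.mp hy)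
    · intro hy
      obtain ⟨x, hx, rfl⟩ := hU hy
      exact ⟨⟨x, hx, rfl⟩, Ideal.Quotient.eq_zero_iff_mem.mpr ((h x hx).mpr hy)⟩
  refine ⟨b, fun x hx i => ?_, hJb, hrank hV fun x hx => ?_, hrank hW fun x hx => ?_⟩
  · rw [hb] at hx ⊢
    refine ⟨fun j hj => ?_, ?_, ?_⟩ <;> rw [homogeneousComponent_homogeneousComponent] <;>
      split_ifs with h
    · exact h ▸ hx.1 j hj
    · exact zero_mem _
    · exact h ▸ hx.2.1
    · simp
    · exact h ▸ hx.2.2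
    · simp
  · have h1 (j : ℕ) (hj : j ≠ d) : homogeneousComponent j x = 0 := by
      rw [homogeneousComponent_of_mem hx, if_neg hj]
    rw [hb]
    simp only [P, h1 (d + 1) (by omega), homogeneousComponent_eq_self hx, map_zero, zero_mem,
      and_true]
    exact ⟨fun h => h.2, fun h => ⟨fun j hj => by rw [h1 j hj.ne]; exact zero_mem _, h⟩⟩
  · have h1 (j : ℕ) (hj : j ≠ d + 1) : homogeneousComponent j x = 0 := by
      rw [homogeneousComponent_of_mem hx, if_neg hj]
    rw [hb]
    simp only [P, h1 d (by omega), homogeneousComponent_eq_self hx, map_zero, zero_mem, true_and]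
    exact ⟨fun h => h.2, fun h => ⟨fun j hj => by rw [h1 j (by omega)]; exact zero_mem _, h⟩⟩

/-- The projection of a graded quotient onto its component of degree `d`. -/
noncomputable def componentMap {J : Ideal (MvPolynomial (Fin n) K)} (hJ : IsGradedIdeal J)
    (d : ℕ) : (MvPolynomial (Fin n) K ⧸ J) →ₗ[K] (MvPolynomial (Fin n) K ⧸ J) :=
  (Submodule.Quotient.restrictScalarsEquiv K J).toLinearMap ∘ₗ
    Submodule.mapQ (J.restrictScalars K) (J.restrictScalars K) (homogeneousComponent d)
      (fun x hx => hJ x hx d) ∘ₗ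
    (Submodule.Quotient.restrictScalarsEquiv K J).symm.toLinearMap

variable {J : Ideal (MvPolynomial (Fin n) K)} (hJ : IsGradedIdeal J)

lemma componentMap_mk (d : ℕ) (x : MvPolynomial (Fin n) K) :
    componentMap hJ d (Ideal.Quotient.mk J x) =
      Ideal.Quotient.mk J (homogeneousComponent d x) := rfl

lemma componentMap_mem (d : ℕ) (y : MvPolynomial (Fin n) K ⧸ J) :
    componentMap hJ d y ∈ gradedPiece J d := by
  obtain ⟨x, rfl⟩ := Ideal.Quotient.mk_surjective y
  exact mk_mem_gradedPiece J (homogeneousComponent_isHomogeneous d x)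

lemma componentMap_of_mem {d : ℕ} {y : MvPolynomial (Fin n) K ⧸ J} (hy : y ∈ gradedPiece J d)
    (j : ℕ) : componentMap hJ j y = if j = d then y else 0 := by
  obtain ⟨x, hx, rfl⟩ := hy
  refine (componentMap_mk hJ j x).trans ?_
  rw [homogeneousComponent_of_mem hx]
  split_ifs
  · rfl
  · rw [map_zero]

lemma componentMap_add_mul {a : ℕ} {z : MvPolynomial (Fin n) K ⧸ J} (hz : z ∈ gradedPiece J a)
    (y : MvPolynomial (Fin n) K ⧸ J) (j : ℕ) :
    componentMap hJ (a + j) (z * y) = z * componentMap hJ j y := by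
  obtain ⟨f, hf, rfl⟩ := hz
  obtain ⟨x, rfl⟩ := Ideal.Quotient.mk_surjective y
  change componentMap hJ _ (Ideal.Quotient.mk J f * _) = Ideal.Quotient.mk J f * _
  rw [← map_mul, componentMap_mk, homogeneousComponent_add_mul hf, map_mul, componentMap_mk]

lemma componentMap_mul_of_lt {a : ℕ} {z : MvPolynomial (Fin n) K ⧸ J} (hz : z ∈ gradedPiece J a)
    (y : MvPolynomial (Fin n) K ⧸ J) {j : ℕ} (hj : j < a) :
    componentMap hJ j (z * y) = 0 := by
  obtain ⟨f, hf, rfl⟩ := hz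
  obtain ⟨x, rfl⟩ := Ideal.Quotient.mk_surjective y
  change componentMap hJ _ (Ideal.Quotient.mk J f * _) = 0
  rw [← map_mul, componentMap_mk, homogeneousComponent_mul_of_lt hf _ hj, map_zero]

lemma eq_zero_of_componentMap {N : ℕ} (hN : ∀ d, N < d → gradedPiece J d = ⊥)
    {y : MvPolynomial (Fin n) K ⧸ J} (hy : ∀ d < N + 1, componentMap hJ d y = 0) : y = 0 := by
  obtain ⟨x, rfl⟩ := Ideal.Quotient.mk_surjective y
  rw [← sum_homogeneousComponent x, map_sum]
  refine Finset.sum_eq_zero fun d _ => ?_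
  rw [← componentMap_mk hJ]
  by_cases hd : d < N + 1
  · exact hy d hd
  · have := componentMap_mem hJ d (Ideal.Quotient.mk J x)
    rwa [hN d (by omega), Submodule.mem_bot] at this

include hJ in
lemma finite_quotient {N : ℕ} (hN : ∀ d, N < d → gradedPiece J d = ⊥) :
    Module.Finite K (MvPolynomial (Fin n) K ⧸ J) := by
  let g : (MvPolynomial (Fin n) K ⧸ J) →ₗ[K] (Π d : Fin (N + 1), gradedPiece J d) :=
    LinearMap.pi fun d => (componentMap hJ d).codRestrict _ (componentMap_mem hJ d)
  refine Module.Finite.of_injective g ?_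
  rw [← LinearMap.ker_eq_bot, LinearMap.ker_eq_bot']
  intro y hy
  exact eq_zero_of_componentMap hJ hN fun d hd =>
    congrArg Subtype.val (congrFun hy ⟨d, hd⟩)

lemma componentMap_mul_eq_zero {a d : ℕ} {z y : MvPolynomial (Fin n) K ⧸ J}
    (hz : z ∈ gradedPiece J a) (hy : ∀ j < d, componentMap hJ j y = 0) {j : ℕ}
    (hj : j < a + d) : componentMap hJ j (z * y) = 0 := by
  by_cases h : j < a
  · exact componentMap_mul_of_lt hJ hz y h
  · obtain ⟨k, rfl⟩ := Nat.exists_eq_add_of_le (not_lt.mp h)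
    rw [componentMap_add_mul hJ hz, hy k (by omega), mul_zero]

/-- The elements of order at least `d` of a graded quotient. -/
noncomputable def orderIdeal (d : ℕ) : Ideal (MvPolynomial (Fin n) K ⧸ J) where
  carrier := {y | ∀ j < d, componentMap hJ j y = 0}
  add_mem' hx hy j hj := by rw [map_add, hx j hj, hy j hj, add_zero]
  zero_mem' j _ := map_zero _
  smul_mem' := by
    intro z y hy j hj
    obtain ⟨x, rfl⟩ := Ideal.Quotient.mk_surjective z
    rw [← sum_homogeneousComponent x, map_sum, Finset.sum_smul, map_sum]
    exact Finset.sum_eq_zero fun i _ => componentMap_mul_eq_zero hJ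
      (mk_mem_gradedPiece J (homogeneousComponent_isHomogeneous i x)) hy (by omega)

lemma gradedPiece_le_orderIdeal {d : ℕ} {y : MvPolynomial (Fin n) K ⧸ J}
    (hy : y ∈ gradedPiece J d) : y ∈ orderIdeal hJ d := fun j hj => by
  rw [componentMap_of_mem hJ hy, if_neg hj.ne]

lemma gradedMaxIdeal_mul_orderIdeal_le (d : ℕ) :
    gradedMaxIdeal J * orderIdeal hJ d ≤ orderIdeal hJ (d + 1) := by
  have : gradedMaxIdeal J ≤ (orderIdeal hJ (d + 1)).colon (orderIdeal hJ d) := by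
    refine Ideal.span_le.mpr ?_
    rintro z ⟨i, hi, hz⟩
    refine Submodule.mem_colon.mpr fun y hy j hj => ?_
    exact componentMap_mul_eq_zero hJ hz hy (by omega)
  exact Ideal.mul_le.mpr fun z hz y hy => Submodule.mem_colon.mp (this hz) y hy

/-- The degree `d` component of the initial ideal of `I`. -/
noncomputable def initialPiece (I : Ideal (MvPolynomial (Fin n) K ⧸ J)) (d : ℕ) :
    Submodule K (MvPolynomial (Fin n) K ⧸ J) :=
  ((I ⊓ orderIdeal hJ d).restrictScalars K).map (componentMap hJ d)

lemma initialPiece_le (I : Ideal (MvPolynomial (Fin n) K ⧸ J)) (d : ℕ) :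
    initialPiece hJ I d ≤ gradedPiece J d := by
  rintro _ ⟨y, _, rfl⟩
  exact componentMap_mem hJ d y

lemma initialPiece_orderIdeal (d : ℕ) :
    initialPiece hJ (orderIdeal hJ d) d = gradedPiece J d := by
  refine le_antisymm (initialPiece_le hJ _ d) fun y hy => ⟨y, ?_, ?_⟩
  · exact ⟨gradedPiece_le_orderIdeal hJ hy, gradedPiece_le_orderIdeal hJ hy⟩
  · rw [componentMap_of_mem hJ hy, if_pos rfl]

lemma X_mul_mem_initialPiece (I : Ideal (MvPolynomial (Fin n) K ⧸ J)) (d : ℕ)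
    {v : MvPolynomial (Fin n) K ⧸ J} (hv : v ∈ initialPiece hJ I d) (i : Fin n) :
    Ideal.Quotient.mk J (X i) * v ∈ initialPiece hJ (gradedMaxIdeal J * I) (d + 1) := by
  obtain ⟨y, ⟨hyI, hy⟩, rfl⟩ := hv
  have hX : Ideal.Quotient.mk J (X i) ∈ gradedPiece J 1 :=
    mk_mem_gradedPiece J (isHomogeneous_X K i)
  refine ⟨Ideal.Quotient.mk J (X i) * y, ⟨?_, fun j hj => ?_⟩, ?_⟩
  · exact Ideal.mul_mem_mul (Ideal.subset_span ⟨1, le_rfl, hX⟩) hyI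
  · exact componentMap_mul_eq_zero hJ hX hy (by omega)
  · rw [add_comm d 1, componentMap_add_mul hJ hX]

lemma finrank_inf_orderIdeal [Module.Finite K (MvPolynomial (Fin n) K ⧸ J)]
    (I : Ideal (MvPolynomial (Fin n) K ⧸ J)) (d : ℕ) :
    finrank K ((I ⊓ orderIdeal hJ d).restrictScalars K) =
      finrank K (initialPiece hJ I d) +
        finrank K ((I ⊓ orderIdeal hJ (d + 1)).restrictScalars K) := by
  rw [initialPiece, ← finrank_map_add_finrank_inf_ker (componentMap hJ d)
    ((I ⊓ orderIdeal hJ d).restrictScalars K)]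
  suffices h : (I ⊓ orderIdeal hJ d).restrictScalars K ⊓ LinearMap.ker (componentMap hJ d) =
      (I ⊓ orderIdeal hJ (d + 1)).restrictScalars K by rw [h]
  ext y
  constructor
  · rintro ⟨⟨hI, hy⟩, hd⟩
    refine ⟨hI, fun j hj => ?_⟩
    rcases Nat.lt_succ_iff_lt_or_eq.mp hj with h | rfl
    · exact hy j h
    · exact hd
  · rintro ⟨hI, hy⟩
    exact ⟨⟨hI, fun j hj => hy j (by omega)⟩, hy d (by omega)⟩

lemma finrank_eq_sum_initialPiece [Module.Finite K (MvPolynomial (Fin n) K ⧸ J)] {N : ℕ}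
    (hN : ∀ d, N < d → gradedPiece J d = ⊥) (I : Ideal (MvPolynomial (Fin n) K ⧸ J)) :
    finrank K (I.restrictScalars K) =
      ∑ d ∈ Finset.range (N + 1), finrank K (initialPiece hJ I d) := by
  have h (M : ℕ) : finrank K (I.restrictScalars K) =
      ∑ d ∈ Finset.range M, finrank K (initialPiece hJ I d) +
        finrank K ((I ⊓ orderIdeal hJ M).restrictScalars K) := by
    induction M with
    | zero =>
      have : I ⊓ orderIdeal hJ 0 = I := inf_eq_left.mpr fun y _ j hj => absurd hj (by omega)
      rw [this, Finset.sum_range_zero, zero_add]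
    | succ M ih => rw [ih, finrank_inf_orderIdeal, Finset.sum_range_succ, add_assoc]
  rw [h (N + 1), Nat.add_eq_left, Submodule.finrank_eq_zero, Submodule.eq_bot_iff]
  rintro y ⟨_, hy⟩
  exact eq_zero_of_componentMap hJ hN hy

end AssociatedGraded

section Sperner

variable {K : Type*} [Field K]

lemma nu_add_finrank {A : Type*} [CommRing A] [Algebra K A] [Module.Finite K A] (m I : Ideal A) :
    nu K m I + finrank K ((m * I).restrictScalars K) = finrank K (I.restrictScalars K) := by
  have hle : (m * I).restrictScalars K ≤ I.restrictScalars K := fun _ hx => Ideal.mul_le_right hx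
  rw [nu, ← (Submodule.comapSubtypeEquivOfLe hle).finrank_eq]
  exact Submodule.finrank_quotient_add_finrank _

/-- Telescoping estimate for sequences `v d ≤ h d` and `w d` with `v d ≤ w (d + 1)` before the
peak `p` and `h (d + 1) + v d ≤ h d + w (d + 1)` from `p` on. -/
lemma sum_le_add_sum {h v w : ℕ → ℕ} {p : ℕ} (hv : ∀ d, v d ≤ h d)
    (hup : ∀ d < p, v d ≤ w (d + 1)) (hdown : ∀ d ≥ p, h (d + 1) + v d ≤ h d + w (d + 1))
    {M : ℕ} (hM : p ≤ M) :
    ∑ d ∈ Finset.range (M + 1), v d ≤ h p + ∑ d ∈ Finset.range (M + 1), w d := by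
  have h1 : ∀ M ≤ p, ∑ d ∈ Finset.range (M + 1), v d ≤
      v M + ∑ d ∈ Finset.range (M + 1), w d := by
    intro M hM
    induction M with
    | zero => simp
    | succ M ih =>
      have := ih (by omega)
      have := hup M (by omega)
      rw [Finset.sum_range_succ, Finset.sum_range_succ w]
      omega
  have h2 : ∑ d ∈ Finset.range (M + 1), v d + h M ≤
      h p + v M + ∑ d ∈ Finset.range (M + 1), w d := by
    induction M, hM using Nat.le_induction with
    | base => have := h1 p le_rfl; omega
    | succ M hM ih =>
      have := hdown M hM
      rw [Finset.sum_range_succ, Finset.sum_range_succ w]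
      omega
  have := hv M
  omega

end Sperner

/-- **The EGH conjecture implies the Sperner property of complete intersections.**
Let `A = R/(f_1,…,f_n)` be a graded Artinian complete intersection, defined by a homogeneous
regular sequence of degrees `a_1,…,a_n`.  If the Eisenbud–Green–Harris conjecture holds for
`A` — every graded ideal `b ⊇ (f_1,…,f_n)` has the same Hilbert function as some graded ideal
`c ⊇ (x_1^{a_1},…,x_n^{a_n})` — then `A` has the Sperner property: the maximum of `μ(I)` over
all ideals `I ⊆ A` is `max_i dim_K A_i`. -/
theorem egh_implies_sperner {K : Type*} [Field K] {n : ℕ}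
    (f : Fin n → MvPolynomial (Fin n) K) (a : Fin n → ℕ) (hpos : ∀ i, 0 < a i)
    (hhom : ∀ i, (f i).IsHomogeneous (a i))
    (hreg : RingTheory.Sequence.IsRegular (MvPolynomial (Fin n) K) (List.ofFn f))
    (hEGH : ∀ b : Ideal (MvPolynomial (Fin n) K), IsGradedIdeal b →
      Ideal.span (Set.range f) ≤ b →
      ∃ c : Ideal (MvPolynomial (Fin n) K), IsGradedIdeal c ∧
        Ideal.span (Set.range fun i : Fin n => (X i : MvPolynomial (Fin n) K) ^ a i) ≤ c ∧
        ∀ i : ℕ, finrank K (gradedPiece b i) = finrank K (gradedPiece c i)) :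
    ∃ i₀ : ℕ,
      (∀ i : ℕ, finrank K (gradedPiece (Ideal.span (Set.range f)) i) ≤
        finrank K (gradedPiece (Ideal.span (Set.range f)) i₀)) ∧
      IsGreatest
        {d : ℕ | ∃ I : Ideal (MvPolynomial (Fin n) K ⧸ Ideal.span (Set.range f)),
          nu K (gradedMaxIdeal (Ideal.span (Set.range f))) I = d}
        (finrank K (gradedPiece (Ideal.span (Set.range f)) i₀)) := by
  set J := Ideal.span (Set.range f)
  set N := ∑ i, (a i - 1)
  have hJ : IsGradedIdeal J := isGradedIdeal_span_range hhom hreg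
  have hH (d : ℕ) : finrank K (gradedPiece J d) = (boxLevel (fun i => a i - 1) d).ncard :=
    finrank_gradedPiece_span_range hpos hhom hreg d
  have hN : ∀ d, N < d → gradedPiece J d = ⊥ := by
    intro d hd
    rw [← Submodule.finrank_eq_zero, hH, boxLevel_eq_empty hd, Set.ncard_empty]
  have hfin : Module.Finite K (MvPolynomial (Fin n) K ⧸ J) := finite_quotient hJ hN
  have hgrowth : ∀ d (V W : Submodule K (MvPolynomial (Fin n) K ⧸ J)), V ≤ gradedPiece J d →
      W ≤ gradedPiece J (d + 1) → (∀ v ∈ V, ∀ i, Ideal.Quotient.mk J (X i) * v ∈ W) →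
      (d < (N + 1) / 2 → finrank K V ≤ finrank K W) ∧
      ((N + 1) / 2 ≤ d → finrank K (gradedPiece J (d + 1)) + finrank K V ≤
        finrank K (gradedPiece J d) + finrank K W) := by
    intro d V W hV hW hVW
    obtain ⟨b, hb, hJb, h1, h2⟩ := exists_gradedIdeal hJ hV hW hVW
    obtain ⟨c, hc, hac, hbc⟩ := hEGH b hb hJb
    have ha (i : Fin n) : (X i : MvPolynomial (Fin n) K) ^ a i ∈ c :=
      hac (Ideal.subset_span ⟨i, rfl⟩)
    rw [hbc] at h1 h2
    refine ⟨fun hd => ?_, fun hd => ?_⟩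
    · have := ncard_boxLevel_add_le hc ha (d := d) (by omega)
      rw [← hH, ← hH] at this
      omega
    · have := finrank_gradedPiece_succ_le hc ha (d := d) (by omega)
      omega
  have hbound (I : Ideal (MvPolynomial (Fin n) K ⧸ J)) :
      nu K (gradedMaxIdeal J) I ≤ finrank K (gradedPiece J ((N + 1) / 2)) := by
    have h1 := nu_add_finrank (K := K) (gradedMaxIdeal J) I
    rw [finrank_eq_sum_initialPiece hJ hN, finrank_eq_sum_initialPiece hJ hN I] at h1
    have hg (d : ℕ) := hgrowth d _ _ (initialPiece_le hJ I d)
      (initialPiece_le hJ (gradedMaxIdeal J * I) (d + 1))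
      fun v hv i => X_mul_mem_initialPiece hJ I d hv i
    have h2 := sum_le_add_sum (h := fun d => finrank K (gradedPiece J d))
      (v := fun d => finrank K (initialPiece hJ I d))
      (w := fun d => finrank K (initialPiece hJ (gradedMaxIdeal J * I) d))
      (fun d => Submodule.finrank_mono (initialPiece_le hJ I d))
      (fun d hd => (hg d).1 hd) (fun d hd => (hg d).2 hd) (M := N) (by omega)
    omega
  have hnu (d : ℕ) : finrank K (gradedPiece J d) ≤ nu K (gradedMaxIdeal J) (orderIdeal hJ d) := by
    have h1 := nu_add_finrank (K := K) (gradedMaxIdeal J) (orderIdeal hJ d)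
    have h2 := finrank_inf_orderIdeal hJ (orderIdeal hJ d) d
    have hle : (gradedMaxIdeal J * orderIdeal hJ d).restrictScalars K ≤
        (orderIdeal hJ d ⊓ orderIdeal hJ (d + 1)).restrictScalars K :=
      fun y hy => ⟨Ideal.mul_le_right hy, gradedMaxIdeal_mul_orderIdeal_le hJ d hy⟩
    have h3 := Submodule.finrank_mono hle
    rw [initialPiece_orderIdeal, inf_idem] at h2
    omega
  refine ⟨(N + 1) / 2, fun d => (hnu d).trans (hbound _),
    ⟨_, le_antisymm (hbound _) (hnu _)⟩, ?_⟩
  rintro _ ⟨I, rfl⟩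
  exact hbound I
end

section
/- Let K be a field and R = K[x_1,...,x_n] the polynomial ring with its standard grading. Suppose L_1,...,L_n is a homogeneous regular sequence in R in which each L_j is a product of linear forms. Then the graded Artinian complete intersection A = R/(L_1,...,L_n) has the Sperner property: the maximum of μ(I) over all ideals I of A equals max_i dim_K A_i. -/
open MvPolynomial Module

/-- A polynomial is a (nonempty, finite) product of linear forms, i.e. of homogeneous
polynomials of degree `1`. -/
def IsProductOfLinearForms {K : Type*} [Field K] {n : ℕ} (L : MvPolynomial (Fin n) K) : Prop :=
  ∃ k : ℕ, 0 < k ∧ ∃ g : Fin k → MvPolynomial (Fin n) K,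
    (∀ t, (g t).IsHomogeneous 1) ∧ L = ∏ t, g t

namespace ProductsOfLinearForms

section Grading

variable {K σ : Type*} [Field K]

/-- The graded pieces of the polynomial ring indexed by the integers, zero in negative degrees. -/
noncomputable def intHomogeneous (K σ : Type*) [Field K] : ℤ → Submodule K (MvPolynomial σ K)
  | Int.ofNat n => homogeneousSubmodule σ K n
  | Int.negSucc _ => ⊥

/-- Projection of a polynomial to its component of integral degree `d`. -/
noncomputable def intComponent (K σ : Type*) [Field K] :
    ℤ → MvPolynomial σ K →ₗ[K] MvPolynomial σ K
  | Int.ofNat n => homogeneousComponent n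
  | Int.negSucc _ => 0

/-- An ideal closed under taking homogeneous components. -/
def ComponentClosed (J : Ideal (MvPolynomial σ K)) : Prop :=
  ∀ p ∈ J, ∀ i, homogeneousComponent i p ∈ J

attribute [local instance] MvPolynomial.gradedAlgebra

lemma componentClosed_span {s : Set (MvPolynomial σ K)}
    (hs : ∀ x ∈ s, ∃ i, x.IsHomogeneous i) : ComponentClosed (Ideal.span s) := by
  intro p hp i
  refine homogeneousComponent_mem_of_mem (Ideal.homogeneous_span _ _ fun x hx => ?_) hp i
  obtain ⟨i, hi⟩ := hs x hx
  exact ⟨i, hi⟩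

lemma homogeneousComponent_add_mul {a : MvPolynomial σ K} {i : ℕ} (ha : a.IsHomogeneous i)
    (j : ℕ) (r : MvPolynomial σ K) :
    homogeneousComponent (i + j) (a * r) = a * homogeneousComponent j r := by
  have := DirectSum.coe_decompose_mul_add_of_left_mem (homogeneousSubmodule σ K)
    (i := i) (j := j) (a := a) (b := r) ha
  erw [decomposition.decompose'_apply, decomposition.decompose'_apply] at this
  exact this

lemma homogeneousComponent_mul_eq_zero {a : MvPolynomial σ K} {i n : ℕ} (ha : a.IsHomogeneous i)
    (h : n < i) (r : MvPolynomial σ K) :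
    homogeneousComponent n (a * r) = 0 := by
  have := DirectSum.coe_decompose_mul_of_left_mem_of_not_le (homogeneousSubmodule σ K)
    (i := i) (n := n) (a := a) (b := r) ha h.not_ge
  erw [decomposition.decompose'_apply] at this
  exact this

lemma intComponent_mem (d : ℤ) (p : MvPolynomial σ K) :
    intComponent K σ d p ∈ intHomogeneous K σ d := by
  cases d with
  | ofNat n => exact homogeneousComponent_mem n p
  | negSucc n => exact Submodule.zero_mem _

lemma intComponent_of_mem {d : ℤ} {p : MvPolynomial σ K} (hp : p ∈ intHomogeneous K σ d) :
    intComponent K σ d p = p := by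
  cases d with
  | ofNat n => exact homogeneousComponent_eq_self hp
  | negSucc n => exact ((Submodule.mem_bot K).1 hp).symm

lemma ComponentClosed.intComponent_mem {J : Ideal (MvPolynomial σ K)} (hJ : ComponentClosed J)
    {p : MvPolynomial σ K} (hp : p ∈ J) (d : ℤ) : intComponent K σ d p ∈ J := by
  cases d with
  | ofNat n => exact hJ p hp n
  | negSucc n => exact J.zero_mem

lemma intComponent_linear_mul {l : MvPolynomial σ K} (hl : l.IsHomogeneous 1) (d : ℤ)
    (r : MvPolynomial σ K) :
    intComponent K σ (d + 1) (l * r) = l * intComponent K σ d r := by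
  cases d with
  | ofNat n =>
    have := homogeneousComponent_add_mul hl n r
    rw [add_comm] at this
    exact this
  | negSucc n =>
    cases n with
    | zero =>
      have : (Int.negSucc 0 + 1) = Int.ofNat 0 := rfl
      rw [this]
      simpa [intComponent] using homogeneousComponent_mul_eq_zero hl Nat.zero_lt_one r
    | succ n =>
      have : (Int.negSucc (n + 1) + 1) = Int.negSucc n := by omega
      rw [this]
      simp [intComponent]

lemma linear_mul_mem {l : MvPolynomial σ K} (hl : l.IsHomogeneous 1) {d : ℤ}
    {r : MvPolynomial σ K} (hr : r ∈ intHomogeneous K σ d) :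
    l * r ∈ intHomogeneous K σ (d + 1) := by
  rw [← intComponent_of_mem hr, ← intComponent_linear_mul hl]
  exact intComponent_mem _ _

instance [Finite σ] (d : ℤ) : Module.Finite K (intHomogeneous K σ d) := by
  cases d with
  | ofNat n => exact Module.Finite.iff_fg.2 (homogeneousSubmodule_fg σ K n)
  | negSucc n => exact Module.Finite.iff_fg.2 Submodule.fg_bot

end Grading

section QuotientDimension

variable {K σ : Type*} [Field K]

/-- The dimension of the image of a subspace `V` of the polynomial ring modulo the ideal `b`. -/
noncomputable def quotDim (b : Ideal (MvPolynomial σ K)) (V : Submodule K (MvPolynomial σ K)) : ℕ :=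
  finrank K (V.map (Ideal.Quotient.mkₐ K b).toLinearMap)

lemma finrank_map_add_finrank_inf_ker {M N : Type*} [AddCommGroup M] [Module K M]
    [AddCommGroup N] [Module K N] (T : M →ₗ[K] N) (V : Submodule K M) [Module.Finite K V] :
    finrank K (V.map T) + finrank K ↥(V ⊓ LinearMap.ker T) = finrank K V := by
  have h := LinearMap.finrank_range_add_finrank_ker (T.domRestrict V)
  rw [LinearMap.range_domRestrict, LinearMap.ker_domRestrict] at h
  rw [← h, ← Submodule.map_comap_subtype, Submodule.finrank_map_subtype_eq]

lemma ker_mk (b : Ideal (MvPolynomial σ K)) :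
    LinearMap.ker (Ideal.Quotient.mkₐ K b).toLinearMap = b.restrictScalars K := by
  ext x
  simp [Ideal.Quotient.eq_zero_iff_mem]

lemma quotDim_add (b : Ideal (MvPolynomial σ K)) (V : Submodule K (MvPolynomial σ K))
    [Module.Finite K V] :
    quotDim b V + finrank K ↥(V ⊓ b.restrictScalars K) = finrank K V := by
  rw [quotDim, ← ker_mk, finrank_map_add_finrank_inf_ker]

lemma quotDim_mono (b : Ideal (MvPolynomial σ K)) {V W : Submodule K (MvPolynomial σ K)}
    [Module.Finite K W] (h : V ≤ W) : quotDim b V ≤ quotDim b W :=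
  Submodule.finrank_mono (Submodule.map_mono h)

lemma quotDim_sup_of_le {b : Ideal (MvPolynomial σ K)} (V : Submodule K (MvPolynomial σ K))
    {N : Submodule K (MvPolynomial σ K)} (h : N ≤ b.restrictScalars K) :
    quotDim b (V ⊔ N) = quotDim b V := by
  have h0 : N.map (Ideal.Quotient.mkₐ K b).toLinearMap = ⊥ :=
    LinearMap.le_ker_iff_map.1 (h.trans (ker_mk b).ge)
  rw [quotDim, Submodule.map_sup, h0, sup_bot_eq, quotDim]

lemma quotDim_top (V : Submodule K (MvPolynomial σ K)) : quotDim ⊤ V = 0 := by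
  have h0 : V.map (Ideal.Quotient.mkₐ K (⊤ : Ideal (MvPolynomial σ K))).toLinearMap = ⊥ :=
    LinearMap.le_ker_iff_map.1 (by rw [ker_mk]; exact fun _ _ => trivial)
  rw [quotDim, h0, finrank_bot]

/-- Degree `d` elements whose product with `f` lies in `V`. -/
noncomputable def colon (f : MvPolynomial σ K) (V : Submodule K (MvPolynomial σ K)) (d : ℤ) :
    Submodule K (MvPolynomial σ K) :=
  intHomogeneous K σ d ⊓ V.comap (LinearMap.mulLeft K f)

lemma mem_colon {f : MvPolynomial σ K} {V : Submodule K (MvPolynomial σ K)} {d : ℤ}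
    {r : MvPolynomial σ K} :
    r ∈ colon f V d ↔ r ∈ intHomogeneous K σ d ∧ f * r ∈ V := Iff.rfl

lemma colon_intHomogeneous {f : MvPolynomial σ K} (hf : f.IsHomogeneous 1) (d : ℤ) :
    colon f (intHomogeneous K σ (d + 1)) d = intHomogeneous K σ d :=
  inf_eq_left.2 fun _ hr => linear_mul_mem hf hr

/-- Additivity of dimensions along
`0 → (R/(J, g))(-1) → R/(J, f * g) → R/(J, f) → 0` for a linear form `f` regular modulo `J`. -/
lemma quotDim_mul [Finite σ] {J : Ideal (MvPolynomial σ K)} (hJ : ComponentClosed J)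
    {f g : MvPolynomial σ K} (hf : f.IsHomogeneous 1) (hreg : ∀ r, f * r ∈ J → r ∈ J)
    {d : ℤ} {V : Submodule K (MvPolynomial σ K)} (hV : V ≤ intHomogeneous K σ (d + 1))
    (hJV : intHomogeneous K σ (d + 1) ⊓ J.restrictScalars K ≤ V) :
    quotDim (J ⊔ Ideal.span {f * g}) V =
      quotDim (J ⊔ Ideal.span {f}) V + quotDim (J ⊔ Ideal.span {g}) (colon f V d) := by
  have : Module.Finite K V := Submodule.finiteDimensional_of_le hV
  have hc : colon f V d ≤ intHomogeneous K σ d := inf_le_left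
  have : Module.Finite K (colon f V d) := Submodule.finiteDimensional_of_le hc
  set b := J ⊔ Ideal.span {f * g} with hb
  set b1 := J ⊔ Ideal.span {f} with hb1
  set b2 := J ⊔ Ideal.span {g} with hb2
  have hbb1 : b ≤ b1 := by
    refine sup_le le_sup_left ?_
    rw [Ideal.span_singleton_le_iff_mem]
    exact Ideal.mul_mem_right _ _ (le_sup_right (a := J) (Ideal.mem_span_singleton_self f))
  set N : Submodule K (MvPolynomial σ K) := V ⊓ b1.restrictScalars K with hN
  have : Module.Finite K N := Submodule.finiteDimensional_of_le (inf_le_left : N ≤ V)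
  let T := (Ideal.Quotient.mkₐ K b).toLinearMap ∘ₗ LinearMap.mulLeft K f
  have hT : LinearMap.ker T = b2.restrictScalars K := by
    ext r
    have : r ∈ LinearMap.ker T ↔ f * r ∈ b :=
      Ideal.Quotient.eq_zero_iff_mem
    rw [this, Submodule.restrictScalars_mem]
    constructor
    · intro h
      obtain ⟨y, hy, z, hz, hyz⟩ := Submodule.mem_sup.1 h
      obtain ⟨t, rfl⟩ := Ideal.mem_span_singleton'.1 hz
      have : r - t * g ∈ J := hreg _ (by
        have : f * (r - t * g) = y := by rw [mul_sub, ← hyz]; ring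
        rwa [this])
      exact Submodule.mem_sup.2 ⟨_, this, t * g, Ideal.mem_span_singleton'.2 ⟨t, rfl⟩, by ring⟩
    · intro h
      obtain ⟨y, hy, z, hz, rfl⟩ := Submodule.mem_sup.1 h
      obtain ⟨t, rfl⟩ := Ideal.mem_span_singleton'.1 hz
      exact Submodule.mem_sup.2 ⟨f * y, J.mul_mem_left _ hy, f * (t * g),
        Ideal.mem_span_singleton'.2 ⟨t, by ring⟩, by ring⟩
  have himg : (colon f V d).map T = N.map (Ideal.Quotient.mkₐ K b).toLinearMap := by
    apply le_antisymm
    · rintro _ ⟨r, hr, rfl⟩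
      exact ⟨f * r, ⟨(mem_colon.1 hr).2, Ideal.mul_mem_right _ _
        (le_sup_right (a := J) (Ideal.mem_span_singleton_self f))⟩, rfl⟩
    · rintro _ ⟨u, ⟨huV, hu⟩, rfl⟩
      obtain ⟨y, hy, z, hz, hyz⟩ := Submodule.mem_sup.1 hu
      obtain ⟨t, rfl⟩ := Ideal.mem_span_singleton'.1 hz
      have hu' := congrArg (intComponent K σ (d + 1)) hyz
      rw [intComponent_of_mem (hV huV), map_add, mul_comm t f, intComponent_linear_mul hf] at hu'
      have hyJ := hJ.intComponent_mem hy (d + 1)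
      refine ⟨intComponent K σ d t, mem_colon.2 ⟨intComponent_mem _ _, ?_⟩, ?_⟩
      · rw [← eq_sub_iff_add_eq'] at hu'
        rw [hu']
        exact V.sub_mem huV (hJV ⟨intComponent_mem _ _, hyJ⟩)
      · refine Ideal.Quotient.eq.2 ?_
        change f * intComponent K σ d t - u ∈ b
        rw [← hu', sub_add_cancel_right]
        exact b.neg_mem (le_sup_left (a := J) hyJ)
  have e1 := quotDim_add b V
  have e2 := quotDim_add b1 V
  have e3 := finrank_map_add_finrank_inf_ker (Ideal.Quotient.mkₐ K b).toLinearMap N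
  have e4 := finrank_map_add_finrank_inf_ker T (colon f V d)
  have e5 := quotDim_add b2 (colon f V d)
  have hNb : N ⊓ b.restrictScalars K = V ⊓ b.restrictScalars K := by
    rw [hN, inf_assoc, inf_eq_right.2 (show b.restrictScalars K ≤ b1.restrictScalars K from hbb1)]
  rw [ker_mk, hNb] at e3
  rw [hT, himg] at e4
  rw [← hN] at e2
  omega

end QuotientDimension

section LogConcave

/-- Log-concavity without internal zeros of a sequence of natural numbers indexed by `ℤ`. -/
def IsLogConcave (h : ℤ → ℕ) : Prop :=
  ∀ i j, i ≤ j → h i * h (j + 1) ≤ h (i + 1) * h j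

lemma IsLogConcave.mul_le_of_add_le_sub {h : ℤ → ℕ} (hh : IsLogConcave h) (e : ℕ) :
    ∀ a d : ℤ, a + e ≤ d - e → h a * h d ≤ h (a + e) * h (d - e) := by
  induction e with
  | zero => intro a d _; simp
  | succ e ih =>
    intro a d had
    push_cast at had ⊢
    refine (ih a d (by omega)).trans ?_
    have := hh (a + e) (d - e - 1) (by omega)
    rw [sub_add_cancel] at this
    rwa [← add_assoc, ← sub_sub]

lemma IsLogConcave.mul_le {h : ℤ → ℕ} (hh : IsLogConcave h) {a b c d : ℤ} (hab : a ≤ b)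
    (hac : a ≤ c) (heq : a + d = b + c) : h a * h d ≤ h b * h c := by
  rcases le_total b c with hbc | hcb
  · have := hh.mul_le_of_add_le_sub (b - a).toNat a d (by omega)
    convert this using 3 <;> omega
  · have := hh.mul_le_of_add_le_sub (c - a).toNat a d (by omega)
    rw [mul_comm (h b)]
    convert this using 3 <;> omega

/-- Sums of `k` consecutive values of `h`. -/
def windowSum (h : ℤ → ℕ) (k : ℕ) (d : ℤ) : ℕ := ∑ i ∈ Finset.range k, h (d - i)

lemma windowSum_succ_arg (h : ℤ → ℕ) (k : ℕ) (d : ℤ) :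
    windowSum h k (d + 1) + h (d + 1 - k) = windowSum h k d + h (d + 1) := by
  unfold windowSum
  rw [← Finset.sum_range_succ (fun i : ℕ => h (d + 1 - i)), Finset.sum_range_succ']
  simp only [Nat.cast_zero, sub_zero, add_left_inj]
  refine Finset.sum_congr rfl fun i _ => ?_
  congr 1
  push_cast
  ring

lemma windowSum_succ (h : ℤ → ℕ) (k : ℕ) (d : ℤ) :
    windowSum h (k + 1) d = windowSum h k (d - 1) + h d := by
  unfold windowSum
  rw [Finset.sum_range_succ']
  simp only [Nat.cast_zero, sub_zero, add_left_inj]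
  refine Finset.sum_congr rfl fun i _ => ?_
  congr 1
  push_cast
  ring

lemma IsLogConcave.windowSum {h : ℤ → ℕ} (hh : IsLogConcave h) (k : ℕ) :
    IsLogConcave (windowSum h k) := by
  intro i j hij
  have ei := windowSum_succ_arg h k i
  have ej := windowSum_succ_arg h k j
  have h1 : ProductsOfLinearForms.windowSum h k i * h (j + 1) ≤
      h (i + 1) * ProductsOfLinearForms.windowSum h k j := by
    unfold ProductsOfLinearForms.windowSum
    rw [Finset.sum_mul, Finset.mul_sum]
    exact Finset.sum_le_sum fun u _ => hh.mul_le (by omega) (by omega) (by omega)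
  have h2 : h (i + 1 - k) * ProductsOfLinearForms.windowSum h k j ≤
      ProductsOfLinearForms.windowSum h k i * h (j + 1 - k) := by
    unfold ProductsOfLinearForms.windowSum
    rw [Finset.sum_mul, Finset.mul_sum]
    refine Finset.sum_le_sum fun u hu => hh.mul_le ?_ (by omega) (by omega)
    have := Finset.mem_range.1 hu
    omega
  generalize ProductsOfLinearForms.windowSum h k i = x at *
  generalize ProductsOfLinearForms.windowSum h k j = y at *
  generalize ProductsOfLinearForms.windowSum h k (i + 1) = x' at *
  generalize ProductsOfLinearForms.windowSum h k (j + 1) = y' at *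
  zify at *
  nlinarith

/-- The weighted averaging inequality behind the normalized matching property of a product
with a chain. -/
lemma sum_mul_sum_le_of_shift {f a b : ℕ → ℚ} (k : ℕ) (hf : ∀ i, 0 ≤ f i)
    (hlc : ∀ i j, i ≤ j → f i * f (j + 1) ≤ f (i + 1) * f j)
    (ha0 : ∀ i < k, 0 ≤ a i) (ha : ∀ i < k, a i ≤ f (i + 1))
    (hb : ∀ i < k, b i ≤ f i) (hb0 : ∀ i < k, 0 ≤ b i)
    (hab : ∀ i < k, a i * f i ≤ b i * f (i + 1)) (hshift : ∀ i, i + 1 < k → a i ≤ b (i + 1)) :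
    (∑ i ∈ Finset.range k, a i) * ∑ i ∈ Finset.range k, f i ≤
      (∑ i ∈ Finset.range k, b i) * ∑ i ∈ Finset.range k, f (i + 1) := by
  set V := ∑ i ∈ Finset.range k, f (i + 1) with hV
  set W := ∑ i ∈ Finset.range k, f i with hW
  let P : ℕ → ℚ := fun i => ∑ j ∈ Finset.range i, f (j + 1)
  let Q : ℕ → ℚ := fun i => ∑ j ∈ Finset.range i, f j
  let X : ℕ → ℚ := fun i => V * Q (i + 1) - W * P i
  let Y : ℕ → ℚ := fun i => W * P i - V * Q i
  have hPQ : ∀ i, Q (i + 1) = P i + f 0 := fun i => Finset.sum_range_succ' _ _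
  have hP0 : ∀ i, 0 ≤ P i := fun i => Finset.sum_nonneg fun j _ => hf _
  have hPV : ∀ i ≤ k, P i ≤ V := fun i hi =>
    Finset.sum_le_sum_of_subset_of_nonneg (Finset.range_mono hi) fun j _ _ => hf _
  have hX : ∀ i < k, 0 ≤ X i := by
    intro i hi
    have hWV : W + f k = V + f 0 := by
      rw [hW, hV, ← Finset.sum_range_succ, Finset.sum_range_succ']
    have : X i = f 0 * (V - P i) + f k * P i := by
      simp only [X, hPQ]
      rw [show W = V + f 0 - f k by linarith]
      ring
    rw [this]
    have := hPV i hi.le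
    exact add_nonneg (mul_nonneg (hf _) (by linarith)) (mul_nonneg (hf _) (hP0 _))
  have hY : ∀ i ≤ k, 0 ≤ Y i := by
    intro i hi
    have e1 : P i + ∑ j ∈ Finset.Ico i k, f (j + 1) = V := Finset.sum_range_add_sum_Ico _ hi
    have e2 : Q i + ∑ j ∈ Finset.Ico i k, f j = W := Finset.sum_range_add_sum_Ico _ hi
    have : Q i * ∑ j ∈ Finset.Ico i k, f (j + 1) ≤ P i * ∑ j ∈ Finset.Ico i k, f j := by
      simp only [P, Q]
      rw [Finset.sum_mul_sum, Finset.sum_mul_sum]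
      refine Finset.sum_le_sum fun u hu => Finset.sum_le_sum fun v hv => hlc u v ?_
      have := Finset.mem_range.1 hu
      have := Finset.mem_Ico.1 hv
      omega
    simp only [Y]
    rw [← e1, ← e2]
    linarith
  let α : ℕ → ℚ := fun i => a i / f (i + 1)
  have hαa : ∀ i < k, α i * f (i + 1) = a i := by
    intro i hi
    rcases eq_or_ne (f (i + 1)) 0 with h0 | h0
    · have := ha i hi
      have := ha0 i hi
      rw [h0] at *
      linarith
    · exact div_mul_cancel₀ _ h0
  have hstep : ∀ i < k, X i * α i + Y i * (if i = 0 then 0 else α (i - 1)) ≤ V * b i := by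
    intro i hi
    have hXY : X i + Y i = V * f i := by
      simp only [X, Y]
      rw [show Q (i + 1) = Q i + f i from Finset.sum_range_succ _ _]
      ring
    rcases eq_or_ne (f i) 0 with h0 | h0
    · rw [h0, mul_zero] at hXY
      have hx := hX i hi
      have hy := hY i hi.le
      have hx0 : X i = 0 := by linarith
      have hy0 : Y i = 0 := by linarith
      have hbz : b i = 0 := le_antisymm (h0 ▸ hb i hi) (hb0 i hi)
      rw [hx0, hy0, hbz]
      simp
    · have hpos : 0 < f i := lt_of_le_of_ne (hf i) (Ne.symm h0)
      have h1 : α i ≤ b i / f i := by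
        rw [le_div_iff₀ hpos]
        rcases eq_or_ne (f (i + 1)) 0 with h2 | h2
        · simp only [α, h2, div_zero, zero_mul]
          exact hb0 i hi
        · have h2pos : 0 < f (i + 1) := lt_of_le_of_ne (hf _) (Ne.symm h2)
          simp only [α]
          rw [div_mul_eq_mul_div, div_le_iff₀ h2pos]
          exact hab i hi
      have h2 : (if i = 0 then 0 else α (i - 1)) ≤ b i / f i := by
        rcases i with _ | i
        · simpa using div_nonneg (hb0 0 hi) hpos.le
        · simp only [Nat.add_eq_zero_iff, one_ne_zero, and_false, if_false, Nat.add_sub_cancel, α]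
          exact div_le_div_of_nonneg_right (hshift i hi) hpos.le
      have hb' : V * b i = X i * (b i / f i) + Y i * (b i / f i) := by
        rw [← add_mul, hXY]
        field_simp
      rw [hb']
      exact add_le_add (mul_le_mul_of_nonneg_left h1 (hX i hi))
        (mul_le_mul_of_nonneg_left h2 (hY i hi.le))
  have hYs : ∑ i ∈ Finset.range k, Y i * (if i = 0 then 0 else α (i - 1)) =
      ∑ i ∈ Finset.range k, Y (i + 1) * α i := by
    have e1 := Finset.sum_range_succ (fun i => Y i * (if i = 0 then 0 else α (i - 1))) k
    have e2 := Finset.sum_range_succ' (fun i => Y i * (if i = 0 then 0 else α (i - 1))) k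
    have hYk : Y k = 0 := by simp only [Y, P, Q, ← hV, ← hW]; ring
    simp only [hYk, zero_mul, add_zero] at e1
    rw [← e1, e2]
    simp
  calc (∑ i ∈ Finset.range k, a i) * W
      = ∑ i ∈ Finset.range k, (X i * α i + Y (i + 1) * α i) := by
        rw [Finset.sum_mul]
        refine Finset.sum_congr rfl fun i hi => ?_
        rw [← hαa i (Finset.mem_range.1 hi)]
        simp only [X, Y]
        rw [show P (i + 1) = P i + f (i + 1) from Finset.sum_range_succ _ _]
        ring
    _ = ∑ i ∈ Finset.range k, (X i * α i + Y i * (if i = 0 then 0 else α (i - 1))) := by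
        rw [Finset.sum_add_distrib, Finset.sum_add_distrib, hYs]
    _ ≤ ∑ i ∈ Finset.range k, V * b i :=
        Finset.sum_le_sum fun i hi => hstep i (Finset.mem_range.1 hi)
    _ = _ := by rw [← Finset.mul_sum, mul_comm]

lemma sum_mul_windowSum_le {h : ℤ → ℕ} (hh : IsLogConcave h) (d : ℤ) (k : ℕ) {a b : ℕ → ℕ}
    (ha : ∀ i < k, a i ≤ h (d - i)) (hb : ∀ i < k, b i ≤ h (d + 1 - i))
    (hab : ∀ i < k, a i * h (d + 1 - i) ≤ b i * h (d - i))
    (hshift : ∀ i, i + 1 < k → a i ≤ b (i + 1)) :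
    (∑ i ∈ Finset.range k, a i) * windowSum h k (d + 1) ≤
      (∑ i ∈ Finset.range k, b i) * windowSum h k d := by
  have hs : ∀ i : ℕ, h (d + 1 - (i + 1 : ℕ)) = h (d - i) := fun i => by
    congr 1; push_cast; ring
  have := sum_mul_sum_le_of_shift (f := fun i => (h (d + 1 - i) : ℚ)) (a := fun i => (a i : ℚ))
    (b := fun i => (b i : ℚ)) k (fun i => by positivity)
    (fun i j hij => by
      have := hh.mul_le (a := d + 1 - (j + 1 : ℕ)) (b := d + 1 - (i + 1 : ℕ)) (c := d + 1 - j)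
        (d := d + 1 - i) (by push_cast; omega) (by push_cast; omega) (by push_cast; omega)
      rw [mul_comm (h _)] at this
      exact_mod_cast this)
    (fun i _ => by positivity)
    (fun i hi => by simp only [hs]; exact_mod_cast ha i hi)
    (fun i hi => by exact_mod_cast hb i hi)
    (fun i _ => by positivity)
    (fun i hi => by simp only [hs]; exact_mod_cast hab i hi)
    (fun i hi => by exact_mod_cast hshift i hi)
  simp only [hs] at this
  unfold windowSum
  exact_mod_cast this

end LogConcave

section Slicing

variable {K σ : Type*} [Field K] [Finite σ]

/-- The normalized matching property of `R/b` relative to a Hilbert function `h`. -/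
def NormalizedMatching (b : Ideal (MvPolynomial σ K)) (h : ℤ → ℕ) : Prop :=
  ∀ (d : ℤ) (V W : Submodule K (MvPolynomial σ K)),
    V ≤ intHomogeneous K σ d → W ≤ intHomogeneous K σ (d + 1) →
    (∀ l : MvPolynomial σ K, l.IsHomogeneous 1 → ∀ v ∈ V, l * v ∈ W) →
    quotDim b V * h (d + 1) ≤ quotDim b W * h d

/-- A linear form that is regular modulo `J`, and whose quotient has Hilbert function `h` and the
normalized matching property. -/
structure IsMatchingFactor (J : Ideal (MvPolynomial σ K)) (h : ℤ → ℕ) (f : MvPolynomial σ K) :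
    Prop where
  linear : f.IsHomogeneous 1
  regular : ∀ r, f * r ∈ J → r ∈ J
  hilbert : ∀ d, quotDim (J ⊔ Ideal.span {f}) (intHomogeneous K σ d) = h d
  matching : NormalizedMatching (J ⊔ Ideal.span {f}) h

lemma quotDim_prod_intHomogeneous {J : Ideal (MvPolynomial σ K)} (hJ : ComponentClosed J)
    {h : ℤ → ℕ} (fs : Multiset (MvPolynomial σ K)) (hfs : ∀ f ∈ fs, IsMatchingFactor J h f) :
    ∀ d, quotDim (J ⊔ Ideal.span {fs.prod}) (intHomogeneous K σ d) =
      windowSum h (Multiset.card fs) d := by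
  induction fs using Multiset.induction_on with
  | empty => intro d; simp [quotDim_top, windowSum]
  | cons f fs ih =>
    intro d
    have hf := hfs f (Multiset.mem_cons_self _ _)
    obtain ⟨e, rfl⟩ : ∃ e, d = e + 1 := ⟨d - 1, by ring⟩
    rw [Multiset.prod_cons, quotDim_mul hJ hf.linear hf.regular le_rfl inf_le_left, hf.hilbert,
      colon_intHomogeneous hf.linear, ih (fun g hg => hfs g (Multiset.mem_cons_of_mem hg)),
      Multiset.card_cons, windowSum_succ, add_sub_cancel_right, add_comm]

lemma exists_slices {J : Ideal (MvPolynomial σ K)} (hJ : ComponentClosed J) {h : ℤ → ℕ} (k : ℕ) :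
    ∀ fs : Multiset (MvPolynomial σ K), Multiset.card fs = k →
      (∀ f ∈ fs, IsMatchingFactor J h f) →
      ∀ (d : ℤ) (V W : Submodule K (MvPolynomial σ K)) (c : ℕ),
      V ≤ intHomogeneous K σ d → W ≤ intHomogeneous K σ (d + 1) →
      intHomogeneous K σ d ⊓ J.restrictScalars K ≤ V →
      intHomogeneous K σ (d + 1) ⊓ J.restrictScalars K ≤ W →
      (∀ l : MvPolynomial σ K, l.IsHomogeneous 1 → ∀ v ∈ V, l * v ∈ W) →
      (∀ f ∈ fs, c ≤ quotDim (J ⊔ Ideal.span {f}) W) →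
      ∃ a b : ℕ → ℕ,
        quotDim (J ⊔ Ideal.span {fs.prod}) V = ∑ i ∈ Finset.range k, a i ∧
        quotDim (J ⊔ Ideal.span {fs.prod}) W = ∑ i ∈ Finset.range k, b i ∧
        (∀ i < k, a i ≤ h (d - i)) ∧ (∀ i < k, b i ≤ h (d + 1 - i)) ∧
        (∀ i < k, a i * h (d + 1 - i) ≤ b i * h (d - i)) ∧
        (∀ i, i + 1 < k → a i ≤ b (i + 1)) ∧ (0 < k → c ≤ b 0) := by
  induction k with
  | zero =>
    intro fs hk _ d V W c _ _ _ _ _ _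
    obtain rfl := Multiset.card_eq_zero.1 hk
    exact ⟨0, 0, by simp [quotDim_top]⟩
  | succ k ih =>
    intro fs hk hfs d V W c hV hW hJV hJW hVW hc
    classical
    obtain ⟨f, hf, hmin⟩ := Finset.exists_min_image fs.toFinset
      (fun g => quotDim (J ⊔ Ideal.span {g}) V) (by
        obtain ⟨g, hg⟩ := Multiset.card_pos_iff_exists_mem.1 (by omega : 0 < Multiset.card fs)
        exact ⟨g, by simpa using hg⟩)
    simp only [Multiset.mem_toFinset] at hf hmin
    obtain ⟨gs, rfl⟩ := Multiset.exists_cons_of_mem hf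
    rw [Multiset.card_cons, add_left_inj] at hk
    have hmf := hfs f hf
    obtain ⟨e, rfl⟩ : ∃ e, d = e + 1 := ⟨d - 1, by ring⟩
    have hJc : ∀ {U : Submodule K (MvPolynomial σ K)} {m : ℤ},
        intHomogeneous K σ (m + 1) ⊓ J.restrictScalars K ≤ U →
        intHomogeneous K σ m ⊓ J.restrictScalars K ≤ colon f U m := fun hU r hr =>
      mem_colon.2 ⟨hr.1, hU ⟨linear_mul_mem hmf.linear hr.1, J.mul_mem_left _ hr.2⟩⟩
    have hWfin : Module.Finite K (colon f W (e + 1)) :=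
      Submodule.finiteDimensional_of_le (inf_le_left : _ ≤ intHomogeneous K σ (e + 1))
    obtain ⟨a, b, ha, hb, hah, hbh, hab, hsh, hcb⟩ := ih gs hk
      (fun g hg => hfs g (Multiset.mem_cons_of_mem hg)) e (colon f V e) (colon f W (e + 1))
      (quotDim (J ⊔ Ideal.span {f}) V) inf_le_left inf_le_left (hJc hJV) (hJc hJW)
      (fun l hl v hv => mem_colon.2 ⟨linear_mul_mem hl (mem_colon.1 hv).1, by
        rw [mul_left_comm]
        exact hVW l hl _ (mem_colon.1 hv).2⟩)
      (fun g hg => (hmin g (Multiset.mem_cons_of_mem hg)).trans (quotDim_mono _ fun v hv =>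
        mem_colon.2 ⟨hV hv, hVW f hmf.linear v hv⟩))
    refine ⟨fun i => Nat.casesOn i (quotDim (J ⊔ Ideal.span {f}) V) a,
      fun i => Nat.casesOn i (quotDim (J ⊔ Ideal.span {f}) W) b, ?_, ?_, ?_, ?_, ?_, ?_, ?_⟩
    · rw [Multiset.prod_cons, quotDim_mul hJ hmf.linear hmf.regular hV hJV, ha,
        Finset.sum_range_succ', add_comm]
      rfl
    · rw [Multiset.prod_cons, quotDim_mul hJ hmf.linear hmf.regular hW hJW, hb,
        Finset.sum_range_succ', add_comm]
      rfl
    · rintro (_ | i) hi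
      · simpa [← hmf.hilbert] using quotDim_mono _ hV
      · have := hah i (by omega)
        rwa [show e + 1 - ((i + 1 : ℕ) : ℤ) = e - i by push_cast; ring]
    · rintro (_ | i) hi
      · simpa [← hmf.hilbert] using quotDim_mono _ hW
      · have := hbh i (by omega)
        rwa [show e + 1 + 1 - ((i + 1 : ℕ) : ℤ) = e + 1 - i by push_cast; ring]
    · rintro (_ | i) hi
      · simpa using hmf.matching (e + 1) V W hV hW hVW
      · have := hab i (by omega)
        rwa [show e + 1 + 1 - ((i + 1 : ℕ) : ℤ) = e + 1 - i by push_cast; ring,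
          show e + 1 - ((i + 1 : ℕ) : ℤ) = e - i by push_cast; ring]
    · rintro (_ | i) hi
      · exact hcb (by omega)
      · exact hsh i (by omega)
    · intro _
      exact hc f hf

lemma normalizedMatching_prod {J : Ideal (MvPolynomial σ K)} (hJ : ComponentClosed J)
    {h : ℤ → ℕ} (hh : IsLogConcave h) (fs : Multiset (MvPolynomial σ K))
    (hfs : ∀ f ∈ fs, IsMatchingFactor J h f) :
    NormalizedMatching (J ⊔ Ideal.span {fs.prod}) (windowSum h (Multiset.card fs)) := by
  intro d V W hV hW hVW
  have hle : ∀ m : ℤ, intHomogeneous K σ m ⊓ J.restrictScalars K ≤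
      (J ⊔ Ideal.span {fs.prod}).restrictScalars K := fun m r hr =>
    le_sup_left (a := J) hr.2
  rw [← quotDim_sup_of_le V (hle d), ← quotDim_sup_of_le W (hle (d + 1))]
  obtain ⟨a, b, ha, hb, hah, hbh, hab, hsh, -⟩ := exists_slices hJ _ fs rfl hfs d
    (V ⊔ intHomogeneous K σ d ⊓ J.restrictScalars K)
    (W ⊔ intHomogeneous K σ (d + 1) ⊓ J.restrictScalars K) 0 (sup_le hV inf_le_left)
    (sup_le hW inf_le_left) le_sup_right le_sup_right (fun l hl v hv => by
      obtain ⟨x, hx, y, hy, rfl⟩ := Submodule.mem_sup.1 hv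
      rw [mul_add]
      exact Submodule.add_mem_sup (hVW l hl x hx)
        ⟨linear_mul_mem hl hy.1, J.mul_mem_left _ hy.2⟩) (fun _ _ => Nat.zero_le _)
  rw [ha, hb]
  exact sum_mul_windowSum_le hh d _ hah hbh hab hsh

end Slicing

section RegularFamilies

variable {K σ : Type*} [Field K]

lemma mem_sup_span_singleton {A : Type*} [CommRing A] {J : Ideal A} {a x : A} :
    x ∈ J ⊔ Ideal.span {a} ↔ ∃ z, x - z * a ∈ J := by
  constructor
  · intro h
    obtain ⟨y, hy, w, hw, rfl⟩ := Submodule.mem_sup.1 h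
    obtain ⟨z, rfl⟩ := Ideal.mem_span_singleton'.1 hw
    exact ⟨z, by simpa using hy⟩
  · rintro ⟨z, hz⟩
    exact Submodule.mem_sup.2 ⟨_, hz, z * a, Ideal.mem_span_singleton'.2 ⟨z, rfl⟩, by ring⟩

lemma regular_of_regular_sup {J : Ideal (MvPolynomial σ K)} (hJ : ComponentClosed J)
    {a b : MvPolynomial σ K} {i : ℕ} (hi : 0 < i) (hai : a.IsHomogeneous i)
    (ha : ∀ r, a * r ∈ J → r ∈ J)
    (hb : ∀ r, b * r ∈ J ⊔ Ideal.span {a} → r ∈ J ⊔ Ideal.span {a})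
    (r : MvPolynomial σ K) (hr : b * r ∈ J) : r ∈ J := by
  have key : ∀ t : ℕ, ∃ v, r - a ^ t * v ∈ J ∧ b * v ∈ J := by
    intro t
    induction t with
    | zero => exact ⟨r, by simp, hr⟩
    | succ t ih =>
      obtain ⟨v, hv, hbv⟩ := ih
      obtain ⟨z, hz⟩ := mem_sup_span_singleton.1 (hb v (le_sup_left (a := J) hbv))
      refine ⟨z, ?_, ha _ ?_⟩
      · have : r - a ^ (t + 1) * z = (r - a ^ t * v) + a ^ t * (v - z * a) := by ring
        rw [this]
        exact J.add_mem hv (J.mul_mem_left _ hz)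
      · have : a * (b * z) = b * v - b * (v - z * a) := by ring
        rw [this]
        exact J.sub_mem hbv (J.mul_mem_left _ hz)
  rw [← sum_homogeneousComponent r]
  refine J.sum_mem fun n _ => ?_
  obtain ⟨v, hv, -⟩ := key (n + 1)
  have h := hJ _ hv n
  rwa [map_sub, homogeneousComponent_mul_eq_zero (hai.pow (n + 1)) (by nlinarith) v, sub_zero] at h

lemma regular_sup_swap {A : Type*} [CommRing A] {J : Ideal A} {a b : A}
    (ha : ∀ r, a * r ∈ J → r ∈ J)
    (hb : ∀ r, b * r ∈ J ⊔ Ideal.span {a} → r ∈ J ⊔ Ideal.span {a})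
    (r : A) (hr : a * r ∈ J ⊔ Ideal.span {b}) : r ∈ J ⊔ Ideal.span {b} := by
  obtain ⟨z, hz⟩ := mem_sup_span_singleton.1 hr
  obtain ⟨w, hw⟩ := mem_sup_span_singleton.1 (hb z (mem_sup_span_singleton.2 ⟨r, by
    rw [← J.neg_mem_iff]
    convert hz using 1
    ring⟩))
  refine mem_sup_span_singleton.2 ⟨w, ha _ ?_⟩
  have : a * (r - w * b) = (a * r - z * b) + b * (z - w * a) := by ring
  rw [this]
  exact J.add_mem hz (J.mul_mem_left _ hw)

lemma regular_sup_of_mul {A : Type*} [CommRing A] {J : Ideal A} {f g x : A}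
    (hfg : ∀ r, f * g * r ∈ J → r ∈ J)
    (hx : ∀ r, x * r ∈ J ⊔ Ideal.span {f * g} → r ∈ J ⊔ Ideal.span {f * g})
    (r : A) (hr : x * r ∈ J ⊔ Ideal.span {f}) : r ∈ J ⊔ Ideal.span {f} := by
  obtain ⟨z, hz⟩ := mem_sup_span_singleton.1 hr
  obtain ⟨w, hw⟩ := mem_sup_span_singleton.1 (hx (g * r) (mem_sup_span_singleton.2 ⟨z, by
    convert J.mul_mem_left g hz using 1
    ring⟩))
  refine mem_sup_span_singleton.2 ⟨w, hfg _ ?_⟩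
  convert J.mul_mem_left f hw using 1
  ring

/-- Each member of the family is regular modulo the ideal generated by any set of other members. -/
def IsRegularFamily {ι A : Type*} [CommRing A] (L : ι → A) : Prop :=
  ∀ (s : Set ι) (j : ι), j ∉ s → ∀ r, L j * r ∈ Ideal.span (L '' s) → r ∈ Ideal.span (L '' s)

lemma span_image_insert {ι A : Type*} [CommRing A] (L : ι → A) (a : ι) (s : Set ι) :
    Ideal.span (L '' insert a s) = Ideal.span (L '' s) ⊔ Ideal.span {L a} := by
  rw [Set.image_insert_eq, Ideal.span_insert, sup_comm]

lemma isRegularFamily_of_weaklyRegular {n : ℕ} {L : Fin n → MvPolynomial σ K}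
    (hL : ∀ j, ∃ i, 0 < i ∧ (L j).IsHomogeneous i)
    (hreg : ∀ j r, L j * r ∈ Ideal.span (L '' {i | i < j}) → r ∈ Ideal.span (L '' {i | i < j})) :
    IsRegularFamily L := by
  have hcl : ∀ s : Set (Fin n), ComponentClosed (Ideal.span (L '' s)) := by
    intro s
    refine componentClosed_span ?_
    rintro _ ⟨j, -, rfl⟩
    obtain ⟨i, -, hi⟩ := hL j
    exact ⟨i, hi⟩
  have key : ∀ t : ℕ, ∀ s : Set (Fin n), (∀ i ∈ s, i.val < t) → ∀ j : Fin n, j.val < t → j ∉ s →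
      ∀ r, L j * r ∈ Ideal.span (L '' s) → r ∈ Ideal.span (L '' s) := by
    intro t
    induction t with
    | zero => intro s _ j hj; omega
    | succ t ih =>
      by_cases htn : t < n
      swap
      · intro s _ j _
        exact ih s (fun i _ => by omega) j (by omega)
      let b : Fin n := ⟨t, htn⟩
      have hb : ∀ u : Finset (Fin n), ∀ s : Set (Fin n), s ∪ ↑u = {i | i < b} →
          Disjoint s ↑u →
          ∀ r, L b * r ∈ Ideal.span (L '' s) → r ∈ Ideal.span (L '' s) := by
        intro u
        induction u using Finset.induction_on with
        | empty =>
          intro s hs _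
          rw [Finset.coe_empty, Set.union_empty] at hs
          rw [hs]
          exact hreg b
        | insert a u hau ihu =>
          intro s hs hdis
          rw [Finset.coe_insert] at hs hdis
          have has : a ∉ s := fun h => Set.disjoint_left.1 hdis h (Set.mem_insert _ _)
          obtain ⟨i, hi, hai⟩ := hL a
          have hlt : ∀ i ∈ s ∪ insert a ↑u, i.val < t := fun i h => by
            rw [hs] at h
            exact h
          refine regular_of_regular_sup (hcl s) hi hai
            (ih s (fun i h => hlt i (Or.inl h)) a (hlt a (Or.inr (Set.mem_insert _ _))) has) ?_
          rw [← span_image_insert]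
          refine ihu (insert a s) (by rw [← hs, Set.insert_union, Set.union_insert]) ?_
          rw [Set.disjoint_insert_left]
          exact ⟨by simpa using hau, hdis.mono_right (Set.subset_insert _ _)⟩
      have hb' : ∀ s : Set (Fin n), (∀ i ∈ s, i.val < t) →
          ∀ r, L b * r ∈ Ideal.span (L '' s) → r ∈ Ideal.span (L '' s) := by
        intro s hs
        classical
        refine hb ({i | i < b} \ s).toFinset s ?_ ?_
        · rw [Set.coe_toFinset]
          exact Set.union_sdiff_cancel hs
        · rw [Set.coe_toFinset]
          exact Set.disjoint_sdiff_right
      intro s hs j hj hjs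
      rcases Nat.lt_succ_iff_lt_or_eq.1 hj with hjt | hjt
      · by_cases hbs : b ∈ s
        · have hs' : ∀ i ∈ s \ {b}, i.val < t := fun i hi => by
            have h1 := hs i hi.1
            have h2 : i.val ≠ t := fun h => hi.2 (Fin.ext h)
            omega
          have hins : s = insert b (s \ {b}) := by
            rw [Set.insert_sdiff_singleton, Set.insert_eq_of_mem hbs]
          rw [hins, span_image_insert]
          refine regular_sup_swap (ih _ hs' j hjt fun h => hjs h.1) ?_
          rw [← span_image_insert]
          refine hb' _ fun i hi => ?_
          rcases hi with rfl | hi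
          exacts [hjt, hs' i hi]
        · refine ih s (fun i hi => ?_) j hjt hjs
          have h1 := hs i hi
          have h2 : i.val ≠ t := fun h => hbs ((Fin.ext h : i = b) ▸ hi)
          omega
      · obtain rfl : j = b := Fin.ext hjt
        refine hb' s fun i hi => ?_
        have h1 := hs i hi
        have h2 : i.val ≠ t := fun h => hjs ((Fin.ext h : i = b) ▸ hi)
        omega
  intro s j hjs
  exact key n s (fun i _ => i.2) j j.2 hjs

lemma image_update_of_notMem {ι A : Type*} [DecidableEq ι] (L : ι → A) {m : ι} (f : A) {s : Set ι}
    (h : m ∉ s) : Function.update L m f '' s = L '' s :=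
  Set.image_congr fun i hi => Function.update_of_ne (by rintro rfl; exact h hi) _ _

lemma IsRegularFamily.update {ι A : Type*} [CommRing A] [DecidableEq ι] {L : ι → A}
    (hL : IsRegularFamily L) {m : ι} {f g : A} (hm : L m = f * g) :
    IsRegularFamily (Function.update L m f) := by
  intro s j hjs
  rcases eq_or_ne j m with rfl | hjm
  · rw [image_update_of_notMem L f hjs, Function.update_self]
    intro r hr
    refine hL s j hjs r ?_
    rw [hm]
    convert Ideal.mul_mem_left _ g hr using 1
    ring
  · rw [Function.update_of_ne hjm]
    by_cases hms : m ∈ s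
    · have hins : s = insert m (s \ {m}) := by
        rw [Set.insert_sdiff_singleton, Set.insert_eq_of_mem hms]
      have hmn : m ∉ s \ {m} := fun h => h.2 rfl
      have h1 := hL _ m hmn
      have h2 := hL s j hjs
      rw [hins, span_image_insert, hm] at h2
      rw [hm] at h1
      rw [hins, span_image_insert, image_update_of_notMem L f hmn, Function.update_self]
      exact regular_sup_of_mul h1 h2
    · rw [image_update_of_notMem L f hms]
      exact hL s j hjs

lemma span_range_update {ι A : Type*} [CommRing A] [DecidableEq ι] (L : ι → A) (m : ι) (f : A) :
    Ideal.span (Set.range (Function.update L m f)) =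
      Ideal.span (L '' {m}ᶜ) ⊔ Ideal.span {f} := by
  have h : insert m ({m}ᶜ : Set ι) = Set.univ := by
    ext i
    simp [em]
  rw [← Set.image_univ, ← h, span_image_insert, image_update_of_notMem L f (show m ∉ ({m}ᶜ : Set ι) from fun h => h rfl),
    Function.update_self]

lemma isHomogeneous_multiset_prod (fs : Multiset (MvPolynomial σ K))
    (h : ∀ f ∈ fs, f.IsHomogeneous 1) : fs.prod.IsHomogeneous (Multiset.card fs) := by
  induction fs using Multiset.induction_on with
  | empty => simpa using isHomogeneous_one σ K
  | cons f fs ih =>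
    rw [Multiset.prod_cons, Multiset.card_cons, add_comm]
    exact (h f (Multiset.mem_cons_self _ _)).mul (ih fun g hg => h g (Multiset.mem_cons_of_mem hg))

end RegularFamilies

section BaseCase

variable {K : Type*} [Field K]

lemma one_notMem_span_of_linear {σ : Type*} {s : Set (MvPolynomial σ K)}
    (hs : ∀ x ∈ s, x.IsHomogeneous 1) : (1 : MvPolynomial σ K) ∉ Ideal.span s := by
  intro h
  have hle : Ideal.span s ≤ RingHom.ker (constantCoeff (R := K) (σ := σ)) :=
    Ideal.span_le.2 fun x hx => (hs x hx).coeff_eq_zero (by simp)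
  simpa using hle h

lemma quotDim_eq_zero_of_le {σ : Type*} {b : Ideal (MvPolynomial σ K)}
    {V : Submodule K (MvPolynomial σ K)} (h : V ≤ b.restrictScalars K) : quotDim b V = 0 := by
  have h0 : V.map (Ideal.Quotient.mkₐ K b).toLinearMap = ⊥ :=
    LinearMap.le_ker_iff_map.1 (h.trans (ker_mk b).ge)
  rw [quotDim, h0, finrank_bot]

lemma homogeneousSubmodule_le_pow_idealOfVars {σ : Type*} (m : ℕ) :
    homogeneousSubmodule σ K m ≤ (idealOfVars σ K ^ m).restrictScalars K := fun _ hp =>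
  (mem_pow_idealOfVars_iff' m _).2 fun _ hx => IsHomogeneous.coeff_eq_zero hp hx.ne

variable {n : ℕ} {L : Fin n → MvPolynomial (Fin n) K}

lemma IsRegularFamily.linearIndependent (hL : IsRegularFamily L)
    (hlin : ∀ j, (L j).IsHomogeneous 1) : LinearIndependent K L := by
  refine linearIndependent_iff_notMem_span.2 fun j hj => ?_
  have h1 := hL (Set.univ \ {j}) j (by simp) 1
  rw [mul_one] at h1
  refine one_notMem_span_of_linear ?_ (h1 (Submodule.span_le_restrictScalars K _ _ hj))
  rintro _ ⟨i, -, rfl⟩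
  exact hlin i

lemma IsRegularFamily.idealOfVars_le (hL : IsRegularFamily L)
    (hlin : ∀ j, (L j).IsHomogeneous 1) : idealOfVars (Fin n) K ≤ Ideal.span (Set.range L) := by
  have hle : Submodule.span K (Set.range L) ≤
      Submodule.span K (Set.range (X : Fin n → MvPolynomial (Fin n) K)) := by
    rw [← homogeneousSubmodule_one_eq_span_X]
    refine Submodule.span_le.2 ?_
    rintro _ ⟨j, rfl⟩
    exact hlin j
  have : Module.Finite K (Submodule.span K (Set.range (X : Fin n → MvPolynomial (Fin n) K))) :=
    Module.Finite.span_of_finite K (Set.finite_range _)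
  have heq := Submodule.eq_of_le_of_finrank_le hle (by
    rw [finrank_span_eq_card (hL.linearIndependent hlin)]
    exact finrank_range_le_card _)
  refine Ideal.span_le.2 ?_
  rintro _ ⟨i, rfl⟩
  refine Submodule.span_le_restrictScalars K (MvPolynomial (Fin n) K) _ ?_
  rw [heq]
  exact Submodule.subset_span ⟨i, rfl⟩

/-- The Hilbert function of the base field. -/
def fieldHilbert (d : ℤ) : ℕ := if d = 0 then 1 else 0

lemma isLogConcave_fieldHilbert : IsLogConcave fieldHilbert := by
  intro i j hij
  unfold fieldHilbert
  split_ifs <;> omega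

lemma IsRegularFamily.quotDim_linear (hL : IsRegularFamily L)
    (hlin : ∀ j, (L j).IsHomogeneous 1) (d : ℤ) :
    quotDim (Ideal.span (Set.range L)) (intHomogeneous K (Fin n) d) = fieldHilbert d := by
  cases d with
  | ofNat m =>
    cases m with
    | zero =>
      have h1 : (Ideal.Quotient.mkₐ K (Ideal.span (Set.range L))).toLinearMap 1 ≠ 0 := fun h =>
        one_notMem_span_of_linear (by rintro _ ⟨j, rfl⟩; exact hlin j)
          (Ideal.Quotient.eq_zero_iff_mem.1 h)
      have h2 : intHomogeneous K (Fin n) (Int.ofNat 0) = Submodule.span K {1} := by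
        rw [← Submodule.one_eq_span]
        exact homogeneousSubmodule_zero _
      rw [quotDim, h2, Submodule.map_span, Set.image_singleton, finrank_span_singleton h1]
      rfl
    | succ m =>
      rw [quotDim_eq_zero_of_le]
      · simp [fieldHilbert]
        omega
      · exact (homogeneousSubmodule_le_pow_idealOfVars (m + 1)).trans
          ((Ideal.pow_le_self m.succ_ne_zero).trans (hL.idealOfVars_le hlin))
  | negSucc m => exact quotDim_eq_zero_of_le bot_le

lemma IsRegularFamily.normalizedMatching_linear (hL : IsRegularFamily L)
    (hlin : ∀ j, (L j).IsHomogeneous 1) :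
    NormalizedMatching (Ideal.span (Set.range L)) fieldHilbert := by
  intro d V W hV hW _
  have h := quotDim_mono (Ideal.span (Set.range L)) hV
  rw [hL.quotDim_linear hlin] at h
  unfold fieldHilbert at *
  split_ifs at * <;> omega

end BaseCase

section HilbertFunction

variable {K : Type*} [Field K] {n : ℕ}

lemma windowSum_eq_zero_of_neg {h : ℤ → ℕ} (h0 : ∀ d < 0, h d = 0) (k : ℕ) (d : ℤ) (hd : d < 0) :
    windowSum h k d = 0 :=
  Finset.sum_eq_zero fun i _ => h0 _ (by omega)

lemma windowSum_eq_zero_of_le {h : ℤ → ℕ} {c : ℤ} (hc : ∀ d, c ≤ d → h d = 0) (k : ℕ) (d : ℤ)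
    (hd : c + k ≤ d) : windowSum h k d = 0 :=
  Finset.sum_eq_zero fun i hi => hc _ (by have := Finset.mem_range.1 hi; omega)

/-- A complete intersection of products of `k j` linear forms has a log-concave Hilbert function
depending only on `k`, relative to which it has the normalized matching property. -/
lemma exists_hilbert_normalizedMatching (s : Finset (Fin n)) :
    ∀ k : Fin n → ℕ, (∀ j ∉ s, k j = 1) →
    ∃ h : ℤ → ℕ, IsLogConcave h ∧ (∀ d < 0, h d = 0) ∧ (∃ c, ∀ d, c ≤ d → h d = 0) ∧
      ∀ L : Fin n → MvPolynomial (Fin n) K, IsRegularFamily L →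
      (∀ j, ∃ fs : Multiset (MvPolynomial (Fin n) K), Multiset.card fs = k j ∧
        (∀ f ∈ fs, f.IsHomogeneous 1) ∧ fs.prod = L j) →
      (∀ d, quotDim (Ideal.span (Set.range L)) (intHomogeneous K (Fin n) d) = h d) ∧
        NormalizedMatching (Ideal.span (Set.range L)) h := by
  induction s using Finset.induction_on with
  | empty =>
    intro k hk
    refine ⟨fieldHilbert, isLogConcave_fieldHilbert, fun d hd => by simp [fieldHilbert, hd.ne],
      ⟨1, fun d hd => ?_⟩, fun L hL hfs => ?_⟩
    · rw [fieldHilbert, if_neg (by omega)]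
    · have hlin : ∀ j, (L j).IsHomogeneous 1 := by
        intro j
        obtain ⟨fs, hcard, hf, hprod⟩ := hfs j
        rw [← hprod, ← hk j (Finset.notMem_empty j), ← hcard]
        exact isHomogeneous_multiset_prod fs hf
      exact ⟨hL.quotDim_linear hlin, hL.normalizedMatching_linear hlin⟩
  | insert m s hms ih =>
    intro k hk
    obtain ⟨h, hlc, hneg, ⟨c, hc⟩, hh⟩ := ih (Function.update k m 1) (by
      intro j hj
      rcases eq_or_ne j m with rfl | hjm
      · exact Function.update_self _ _ _
      · rw [Function.update_of_ne hjm]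
        exact hk j (by simp [hjm, hj]))
    refine ⟨windowSum h (k m), hlc.windowSum _, windowSum_eq_zero_of_neg hneg _,
      ⟨c + k m, windowSum_eq_zero_of_le hc _⟩, fun L hL hfs => ?_⟩
    obtain ⟨fs, hcard, hf, hprod⟩ := hfs m
    have hJ : ComponentClosed (Ideal.span (L '' {m}ᶜ)) := by
      refine componentClosed_span ?_
      rintro _ ⟨j, -, rfl⟩
      obtain ⟨gs, -, hg, hgs⟩ := hfs j
      exact ⟨_, hgs ▸ isHomogeneous_multiset_prod gs hg⟩
    have hfac : ∀ f ∈ fs, IsMatchingFactor (Ideal.span (L '' {m}ᶜ)) h f := by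
      classical
      intro f hfm
      have hreg : IsRegularFamily (Function.update L m f) :=
        hL.update (g := (fs.erase f).prod) (by rw [Multiset.prod_erase hfm, hprod])
      have hm : m ∉ ({m}ᶜ : Set (Fin n)) := fun h => h rfl
      obtain ⟨h1, h2⟩ := hh _ hreg (by
        intro j
        rcases eq_or_ne j m with rfl | hjm
        · exact ⟨{f}, by simp, by simpa using hf f hfm, by simp⟩
        · simp only [Function.update_of_ne hjm]
          exact hfs j)
      rw [span_range_update] at h1 h2
      refine ⟨hf f hfm, ?_, h1, h2⟩
      have := hreg _ m hm
      rwa [image_update_of_notMem L f hm, Function.update_self] at this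
    have hspan : Ideal.span (Set.range L) = Ideal.span (L '' {m}ᶜ) ⊔ Ideal.span {fs.prod} := by
      rw [hprod, ← span_range_update, Function.update_eq_self]
    rw [hspan, ← hcard]
    exact ⟨quotDim_prod_intHomogeneous hJ fs hfac, normalizedMatching_prod hJ hlc fs hfac⟩

end HilbertFunction

section Filtration

variable {K σ : Type*} [Field K]

lemma pow_idealOfVars_le_of_quotDim_eq_zero [Finite σ] {b : Ideal (MvPolynomial σ K)} {i : ℕ}
    (h : quotDim b (homogeneousSubmodule σ K i) = 0) : idealOfVars σ K ^ i ≤ b := by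
  have : Module.Finite K (homogeneousSubmodule σ K i) :=
    Module.Finite.iff_fg.2 (homogeneousSubmodule_fg σ K i)
  have hle : homogeneousSubmodule σ K i ≤ b.restrictScalars K := by
    rw [← ker_mk, LinearMap.le_ker_iff_map]
    exact Submodule.finrank_eq_zero.1 h
  rw [pow_idealOfVars_eq_span]
  refine Ideal.span_le.2 ?_
  rintro _ ⟨x, hx, rfl⟩
  exact hle (isHomogeneous_monomial 1 hx)

lemma finite_quotient_of_pow_idealOfVars_le [Finite σ] {b : Ideal (MvPolynomial σ K)} {c : ℕ}
    (hc : idealOfVars σ K ^ c ≤ b) : Module.Finite K (MvPolynomial σ K ⧸ b) := by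
  have hfg : (⨆ i ∈ Finset.range c, homogeneousSubmodule σ K i).FG :=
    Submodule.fg_biSup _ _ fun i _ => homogeneousSubmodule_fg σ K i
  have htop : (⨆ i ∈ Finset.range c, homogeneousSubmodule σ K i).map
      (Ideal.Quotient.mkₐ K b).toLinearMap = ⊤ := by
    rw [eq_top_iff]
    rintro x -
    obtain ⟨p, rfl⟩ := Ideal.Quotient.mk_surjective x
    rw [← sum_homogeneousComponent p, map_sum]
    refine Submodule.sum_mem _ fun i _ => ?_
    by_cases hi : i < c
    · exact ⟨_, Submodule.mem_iSup_of_mem i (Submodule.mem_iSup_of_mem (Finset.mem_range.2 hi)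
        (homogeneousComponent_mem i p)), rfl⟩
    · rw [Ideal.Quotient.eq_zero_iff_mem.2]
      · exact Submodule.zero_mem _
      · exact hc (Ideal.pow_le_pow_right (not_lt.1 hi)
          (homogeneousSubmodule_le_pow_idealOfVars i (homogeneousComponent_mem i p)))
  exact ⟨htop ▸ hfg.map _⟩

lemma homogeneousComponent_eq_zero_of_mem_pow {i : ℕ} {p : MvPolynomial σ K}
    (hp : p ∈ idealOfVars σ K ^ (i + 1)) : homogeneousComponent i p = 0 := by
  ext x
  rw [coeff_homogeneousComponent, coeff_zero]
  split_ifs with hx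
  · exact (mem_pow_idealOfVars_iff' _ _).1 hp x (by omega)
  · rfl

lemma sub_homogeneousComponent_mem_pow {i : ℕ} {p : MvPolynomial σ K}
    (hp : p ∈ idealOfVars σ K ^ i) : p - homogeneousComponent i p ∈ idealOfVars σ K ^ (i + 1) := by
  rw [mem_pow_idealOfVars_iff'] at hp ⊢
  intro x hx
  rw [coeff_sub, coeff_homogeneousComponent]
  split_ifs with h
  · exact sub_self _
  · rw [hp x (by omega), sub_zero]

/-- Leading forms of degree `i` of the elements of `I` of order at least `i`. -/
noncomputable def leadingForms (I : Ideal (MvPolynomial σ K)) (i : ℕ) :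
    Submodule K (MvPolynomial σ K) :=
  ((I ⊓ idealOfVars σ K ^ i).restrictScalars K).map (homogeneousComponent i)

/-- The image in the quotient by `b` of the elements of `I` of order at least `i`. -/
noncomputable def orderFiltration (b I : Ideal (MvPolynomial σ K)) (i : ℕ) :
    Submodule K (MvPolynomial σ K ⧸ b) :=
  ((I ⊓ idealOfVars σ K ^ i).restrictScalars K).map (Ideal.Quotient.mkₐ K b).toLinearMap

lemma leadingForms_le (I : Ideal (MvPolynomial σ K)) (i : ℕ) :
    leadingForms I i ≤ homogeneousSubmodule σ K i := by
  rintro _ ⟨p, -, rfl⟩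
  exact homogeneousComponent_mem i p

lemma leadingForms_mono {I J : Ideal (MvPolynomial σ K)} (h : I ≤ J) (i : ℕ) :
    leadingForms I i ≤ leadingForms J i :=
  Submodule.map_mono fun _ hp => ⟨h hp.1, hp.2⟩

lemma leadingForms_top (i : ℕ) : leadingForms (⊤ : Ideal (MvPolynomial σ K)) i =
    homogeneousSubmodule σ K i :=
  le_antisymm (leadingForms_le _ _) fun p hp =>
    ⟨p, ⟨trivial, homogeneousSubmodule_le_pow_idealOfVars i hp⟩, homogeneousComponent_eq_self hp⟩

lemma finrank_map_eq_add_of_ker_le {M N P : Type*} [AddCommGroup M] [Module K M]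
    [AddCommGroup N] [Module K N] [AddCommGroup P] [Module K P] [Module.Finite K N]
    (q : M →ₗ[K] N) (hq : Function.Surjective q) (T : M →ₗ[K] P)
    (hT : LinearMap.ker q ≤ LinearMap.ker T) (U : Submodule K M) :
    finrank K (U.map q) = finrank K (U.map T) + finrank K ((U ⊓ LinearMap.ker T).map q) := by
  obtain ⟨s, hs⟩ := q.exists_rightInverse_of_surjective (LinearMap.range_eq_top.2 hq)
  have hTs : ∀ x, T (s (q x)) = T x := fun x => by
    rw [← sub_eq_zero, ← map_sub]
    refine hT ?_
    rw [LinearMap.mem_ker, map_sub, sub_eq_zero]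
    exact LinearMap.congr_fun hs (q x)
  have h1 : (U.map q).map (T ∘ₗ s) = U.map T := by
    rw [← Submodule.map_comp]
    ext y
    simp [hTs]
  have h2 : U.map q ⊓ LinearMap.ker (T ∘ₗ s) = (U ⊓ LinearMap.ker T).map q := by
    ext y
    constructor
    · rintro ⟨⟨x, hx, rfl⟩, hy⟩
      exact ⟨x, ⟨hx, (hTs x).symm.trans hy⟩, rfl⟩
    · rintro ⟨x, ⟨hx, hxT⟩, rfl⟩
      exact ⟨⟨x, hx, rfl⟩, (hTs x).trans hxT⟩
  rw [← finrank_map_add_finrank_inf_ker (T ∘ₗ s) (U.map q), h1, h2]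

lemma finrank_orderFiltration {b I : Ideal (MvPolynomial σ K)}
    [Module.Finite K (MvPolynomial σ K ⧸ b)] (hb : ComponentClosed b) (hbI : b ≤ I) (i : ℕ) :
    finrank K (orderFiltration b I i) =
      quotDim b (leadingForms I i) + finrank K (orderFiltration b I (i + 1)) := by
  have hmem : ∀ p, p ∈ LinearMap.ker
      ((Ideal.Quotient.mkₐ K b).toLinearMap ∘ₗ homogeneousComponent i) ↔
      homogeneousComponent i p ∈ b := fun p => Ideal.Quotient.eq_zero_iff_mem
  rw [orderFiltration, finrank_map_eq_add_of_ker_le _ Ideal.Quotient.mk_surjective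
    ((Ideal.Quotient.mkₐ K b).toLinearMap ∘ₗ homogeneousComponent i) (by
      intro p hp
      rw [ker_mk] at hp
      exact (hmem p).2 (hb p hp i)), quotDim, leadingForms,
      ← Submodule.map_comp]
  refine congrArg (fun V : Submodule K (MvPolynomial σ K ⧸ b) => _ + finrank K V) ?_
  apply le_antisymm
  · rintro _ ⟨p, ⟨hp, hpk⟩, rfl⟩
    have hpb := (hmem p).1 hpk
    exact ⟨p - homogeneousComponent i p, ⟨I.sub_mem hp.1 (hbI hpb),
      sub_homogeneousComponent_mem_pow hp.2⟩, Ideal.Quotient.eq.2 (by simpa using hpb)⟩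
  · rintro _ ⟨p, hp, rfl⟩
    refine ⟨p, ⟨⟨hp.1, Ideal.pow_le_pow_right i.le_succ hp.2⟩, (hmem p).2 ?_⟩, rfl⟩
    rw [homogeneousComponent_eq_zero_of_mem_pow hp.2]
    exact b.zero_mem

lemma finrank_orderFiltration_zero {b I : Ideal (MvPolynomial σ K)}
    [Module.Finite K (MvPolynomial σ K ⧸ b)] (hb : ComponentClosed b) (hbI : b ≤ I) {c : ℕ}
    (hc : idealOfVars σ K ^ c ≤ b) :
    finrank K (orderFiltration b I 0) = ∑ i ∈ Finset.range c, quotDim b (leadingForms I i) := by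
  have key : ∀ i, finrank K (orderFiltration b I 0) =
      ∑ j ∈ Finset.range i, quotDim b (leadingForms I j) + finrank K (orderFiltration b I i) := by
    intro i
    induction i with
    | zero => simp
    | succ i ih => rw [ih, finrank_orderFiltration hb hbI, Finset.sum_range_succ, add_assoc]
  have h0 : orderFiltration b I c = ⊥ :=
    LinearMap.le_ker_iff_map.1 (by
      rw [ker_mk]
      exact fun p hp => hc hp.2)
  rw [key c, h0, finrank_bot, add_zero]

lemma orderFiltration_comap_zero (b : Ideal (MvPolynomial σ K))
    (I : Ideal (MvPolynomial σ K ⧸ b)) :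
    orderFiltration b (I.comap (Ideal.Quotient.mk b)) 0 = I.restrictScalars K := by
  apply le_antisymm
  · rintro _ ⟨p, hp, rfl⟩
    exact hp.1
  · intro x hx
    obtain ⟨p, rfl⟩ := Ideal.Quotient.mk_surjective x
    exact ⟨p, ⟨hx, by simp⟩, rfl⟩

lemma orderFiltration_top (b : Ideal (MvPolynomial σ K)) (i : ℕ) :
    orderFiltration b ⊤ i =
      ((idealOfVars σ K ^ i).map (Ideal.Quotient.mk b)).restrictScalars K := by
  ext x
  rw [Submodule.restrictScalars_mem,
    Ideal.mem_map_iff_of_surjective _ Ideal.Quotient.mk_surjective]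
  constructor
  · rintro ⟨p, hp, rfl⟩
    exact ⟨p, hp.2, rfl⟩
  · rintro ⟨p, hp, rfl⟩
    exact ⟨p, ⟨trivial, hp⟩, rfl⟩

end Filtration

section Sperner

variable {K : Type*} [Field K] {n : ℕ}

lemma gradedMaxIdeal_eq (b : Ideal (MvPolynomial (Fin n) K)) :
    gradedMaxIdeal b = (idealOfVars (Fin n) K).map (Ideal.Quotient.mk b) := by
  apply le_antisymm
  · refine Ideal.span_le.2 ?_
    rintro _ ⟨i, hi, p, hp, rfl⟩
    exact Ideal.mem_map_of_mem _
      (Ideal.pow_le_self (by omega) (homogeneousSubmodule_le_pow_idealOfVars i hp))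
  · rw [Ideal.map_span]
    refine Ideal.span_mono ?_
    rintro _ ⟨_, ⟨j, rfl⟩, rfl⟩
    exact ⟨1, le_rfl, X j, isHomogeneous_X K j, rfl⟩

lemma nu_add_finrank {A : Type*} [CommRing A] [Algebra K A] [Module.Finite K A] (m I : Ideal A) :
    nu K m I + finrank K ((m * I).restrictScalars K) = finrank K (I.restrictScalars K) := by
  rw [← Submodule.finrank_quotient_add_finrank (Submodule.comap (I.restrictScalars K).subtype
    ((m * I).restrictScalars K)), nu]
  congr 1
  exact (Submodule.comapSubtypeEquivOfLe
    (show (m * I).restrictScalars K ≤ I.restrictScalars K from Ideal.mul_le_right)).finrank_eq.symm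

lemma sum_le_sum_add_of_matching {a c h : ℕ → ℕ} {H : ℕ} (hH : ∀ i, h i ≤ H)
    (hah : ∀ i, a i ≤ h i) (hca : ∀ i, c i ≤ a i) (h0 : ∀ i, h i = 0 → h (i + 1) = 0)
    (hac : ∀ i, a i * h (i + 1) ≤ c (i + 1) * h i) (N : ℕ) :
    ∑ i ∈ Finset.range N, a i ≤ ∑ i ∈ Finset.range N, c i + H := by
  have key : ∀ i, ∃ α : ℚ, 0 ≤ α ∧ α ≤ 1 ∧ (a i : ℚ) = α * h i ∧
      (∑ j ∈ Finset.range (i + 1), a j : ℚ) ≤ ∑ j ∈ Finset.range (i + 1), (c j : ℚ) + H * α := by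
    intro i
    have hHi : ∀ j, (h j : ℚ) ≤ H := fun j => by exact_mod_cast hH j
    have hahi : ∀ j, (a j : ℚ) ≤ h j := fun j => by exact_mod_cast hah j
    induction i with
    | zero =>
      rcases eq_or_ne (h 0) 0 with hz | hz
      · have := hah 0
        exact ⟨0, le_rfl, zero_le_one, by simp; omega, by simp; omega⟩
      · have hpos : (0 : ℚ) < h 0 := by exact_mod_cast Nat.pos_of_ne_zero hz
        have he : (a 0 : ℚ) = a 0 / h 0 * h 0 := (div_mul_cancel₀ _ hpos.ne').symm
        refine ⟨a 0 / h 0, by positivity, (div_le_one hpos).2 (hahi 0), he, ?_⟩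
        have h1 : (a 0 / h 0 * h 0 : ℚ) ≤ a 0 / h 0 * H :=
          mul_le_mul_of_nonneg_left (hHi 0) (by positivity)
        have h2 : (0 : ℚ) ≤ c 0 := by positivity
        simp only [zero_add, Finset.sum_range_one]
        linarith
    | succ i ih =>
      obtain ⟨α, hα0, hα1, hα, hsum⟩ := ih
      rw [Finset.sum_range_succ _ (i + 1), Finset.sum_range_succ _ (i + 1)]
      rcases eq_or_ne (h (i + 1)) 0 with hz | hz
      · have ha0 : a (i + 1) = 0 := by have := hah (i + 1); omega
        refine ⟨α, hα0, hα1, by simp [ha0, hz], ?_⟩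
        have h2 : (0 : ℚ) ≤ c (i + 1) := by positivity
        rw [ha0, Nat.cast_zero]
        linarith
      · have hpi : (0 : ℚ) < h i := by
          exact_mod_cast Nat.pos_of_ne_zero fun hi => hz (h0 i hi)
        have hpos : (0 : ℚ) < h (i + 1) := by exact_mod_cast Nat.pos_of_ne_zero hz
        have he : (a (i + 1) / h (i + 1) * h (i + 1) : ℚ) = a (i + 1) := div_mul_cancel₀ _ hpos.ne'
        set β : ℚ := a (i + 1) / h (i + 1) with hβ
        have hc1 : α * h (i + 1) ≤ c (i + 1) := by
          have : (a i * h (i + 1) : ℚ) ≤ c (i + 1) * h i := by exact_mod_cast hac i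
          rw [hα] at this
          refine le_of_mul_le_mul_right ?_ hpi
          linarith
        have hc2 : (c (i + 1) : ℚ) ≤ a (i + 1) := by exact_mod_cast hca (i + 1)
        have hαβ : α ≤ β := by
          rw [hβ, le_div_iff₀ hpos]
          exact hc1.trans hc2
        refine ⟨β, hα0.trans hαβ, (div_le_one hpos).2 (hahi _), he.symm, ?_⟩
        have := mul_le_mul_of_nonneg_left (hHi (i + 1)) (sub_nonneg.2 hαβ)
        linarith
  rcases N with _ | N
  · simp
  · obtain ⟨α, hα0, hα1, -, hsum⟩ := key N
    have : (H * α : ℚ) ≤ H := mul_le_of_le_one_right (by positivity) hα1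
    have : (∑ j ∈ Finset.range (N + 1), a j : ℚ) ≤ ∑ j ∈ Finset.range (N + 1), (c j : ℚ) + H := by
      linarith
    exact_mod_cast this

lemma nu_le_of_normalizedMatching {b : Ideal (MvPolynomial (Fin n) K)} (hb : ComponentClosed b)
    {h : ℤ → ℕ} (hh : ∀ d, quotDim b (intHomogeneous K (Fin n) d) = h d)
    (hNM : NormalizedMatching b h) {c : ℕ} (hc : idealOfVars (Fin n) K ^ c ≤ b) {H : ℕ}
    (hH : ∀ i : ℕ, h i ≤ H) (I : Ideal (MvPolynomial (Fin n) K ⧸ b)) :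
    nu K (gradedMaxIdeal b) I ≤ H := by
  have hfin := finite_quotient_of_pow_idealOfVars_le hc
  have hle : ∀ J : Ideal (MvPolynomial (Fin n) K ⧸ b), b ≤ J.comap (Ideal.Quotient.mk b) :=
    fun J p hp => by
      rw [Ideal.mem_comap, Ideal.Quotient.eq_zero_iff_mem.2 hp]
      exact J.zero_mem
  have hdim : ∀ J : Ideal (MvPolynomial (Fin n) K ⧸ b), finrank K (J.restrictScalars K) =
      ∑ i ∈ Finset.range c, quotDim b (leadingForms (J.comap (Ideal.Quotient.mk b)) i) :=
    fun J => by rw [← orderFiltration_comap_zero, finrank_orderFiltration_zero hb (hle J) hc]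
  have hnu := nu_add_finrank (K := K) (gradedMaxIdeal b) I
  have hint : ∀ (J : Ideal (MvPolynomial (Fin n) K)) (i : ℕ),
      leadingForms J i ≤ intHomogeneous K (Fin n) (i : ℤ) := leadingForms_le
  have hfinL : ∀ (J : Ideal (MvPolynomial (Fin n) K)) (i : ℕ),
      Module.Finite K (leadingForms J i) := fun J i =>
    Submodule.finiteDimensional_of_le (hint J i)
  rw [hdim, hdim] at hnu
  have := sum_le_sum_add_of_matching
    (a := fun i => quotDim b (leadingForms (I.comap (Ideal.Quotient.mk b)) i))
    (c := fun i => quotDim b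
      (leadingForms ((gradedMaxIdeal b * I).comap (Ideal.Quotient.mk b)) i))
    (h := fun i => h i) hH (fun i => (quotDim_mono b (hint _ i)).trans_eq (hh i))
    (fun i => quotDim_mono b (leadingForms_mono (Ideal.comap_mono Ideal.mul_le_right) i))
    (fun i hi => by
      have h1 := pow_idealOfVars_le_of_quotDim_eq_zero (b := b) (i := i) ((hh i).trans hi)
      rw [← hh]
      exact quotDim_eq_zero_of_le ((homogeneousSubmodule_le_pow_idealOfVars (i + 1)).trans
        ((Ideal.pow_le_pow_right i.le_succ).trans h1)))
    (fun i => hNM i _ _ (hint _ i) (hint _ (i + 1)) (by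
      rintro l hl _ ⟨p, hp, rfl⟩
      have hlm : l ∈ idealOfVars (Fin n) K := by
        have := homogeneousSubmodule_le_pow_idealOfVars (K := K) 1 hl
        rwa [pow_one] at this
      refine ⟨l * p, ⟨?_, ?_⟩, ?_⟩
      · rw [SetLike.mem_coe, Ideal.mem_comap, map_mul, gradedMaxIdeal_eq]
        exact Ideal.mul_mem_mul (Ideal.mem_map_of_mem _ hlm) hp.1
      · rw [SetLike.mem_coe, pow_succ']
        exact Ideal.mul_mem_mul hlm hp.2
      · rw [add_comm, homogeneousComponent_add_mul hl])) c
  omega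

lemma nu_pow_gradedMaxIdeal {b : Ideal (MvPolynomial (Fin n) K)} (hb : ComponentClosed b)
    {c : ℕ} (hc : idealOfVars (Fin n) K ^ c ≤ b) (i : ℕ) :
    nu K (gradedMaxIdeal b) (gradedMaxIdeal b ^ i) = finrank K (gradedPiece b i) := by
  have hfin := finite_quotient_of_pow_idealOfVars_le hc
  have hnu := nu_add_finrank (K := K) (gradedMaxIdeal b) (gradedMaxIdeal b ^ i)
  have hpow : ∀ j, (gradedMaxIdeal b ^ j).restrictScalars K = orderFiltration b ⊤ j := fun j => by
    rw [orderFiltration_top, gradedMaxIdeal_eq, Ideal.map_pow]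
  rw [← pow_succ', hpow, hpow, finrank_orderFiltration hb le_top i, leadingForms_top,
    add_left_inj] at hnu
  exact hnu

lemma isRegularFamily_of_isRegular {L : Fin n → MvPolynomial (Fin n) K}
    (hL : ∀ j, ∃ i, 0 < i ∧ (L j).IsHomogeneous i)
    (hreg : RingTheory.Sequence.IsRegular (MvPolynomial (Fin n) K) (List.ofFn L)) :
    IsRegularFamily L := by
  refine isRegularFamily_of_weaklyRegular hL fun j r hr => ?_
  have h := (RingTheory.Sequence.isWeaklyRegular_iff _ _).1 hreg.toIsWeaklyRegular j (by simp)
  have hspan : Ideal.ofList ((List.ofFn L).take j) = Ideal.span (L '' {i | i < j}) := by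
    rw [Ideal.ofList]
    congr 1
    ext x
    simp only [Set.mem_ofPred_eq, List.mem_take_iff_getElem, Set.mem_image]
    constructor
    · rintro ⟨i, hi, rfl⟩
      have hi' : i < j := by simp at hi; omega
      exact ⟨⟨i, by omega⟩, hi', by simp⟩
    · rintro ⟨i, hi, rfl⟩
      exact ⟨i, by simpa using hi, by simp⟩
  rw [isSMulRegular_quotient_iff_mem_of_smul_mem] at h
  rw [hspan] at h
  have := h r (by simpa using hr)
  simpa using this

end Sperner

end ProductsOfLinearForms

open ProductsOfLinearForms

/-- **Sperner property of complete intersections cut out by products of linear forms.**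
If `L_1,…,L_n` is a regular sequence in `R = K[x_1,…,x_n]` in which each `L_j` is a product
of linear forms, then `A = R/(L_1,…,L_n)` has the Sperner property: the maximum of `μ(I)`
over all ideals `I ⊆ A` is `max_i dim_K A_i`. -/
theorem sperner_of_ci_products_of_linear_forms {K : Type*} [Field K] {n : ℕ}
    (L : Fin n → MvPolynomial (Fin n) K)
    (hlin : ∀ j, IsProductOfLinearForms (L j))
    (hreg : RingTheory.Sequence.IsRegular (MvPolynomial (Fin n) K) (List.ofFn L)) :
    ∃ i₀ : ℕ,
      (∀ i : ℕ, finrank K (gradedPiece (Ideal.span (Set.range L)) i) ≤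
        finrank K (gradedPiece (Ideal.span (Set.range L)) i₀)) ∧
      IsGreatest
        {d : ℕ | ∃ I : Ideal (MvPolynomial (Fin n) K ⧸ Ideal.span (Set.range L)),
          nu K (gradedMaxIdeal (Ideal.span (Set.range L))) I = d}
        (finrank K (gradedPiece (Ideal.span (Set.range L)) i₀)) := by
  have hfs : ∀ j, ∃ fs : Multiset (MvPolynomial (Fin n) K), 0 < Multiset.card fs ∧
      (∀ f ∈ fs, f.IsHomogeneous 1) ∧ fs.prod = L j := by
    intro j
    obtain ⟨k, hk, g, hg, hL⟩ := hlin j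
    refine ⟨Finset.univ.val.map g, by simpa using hk, fun f hf => ?_, hL.symm⟩
    obtain ⟨t, -, rfl⟩ := Multiset.mem_map.1 hf
    exact hg t
  choose fs hcard hhom hprod using hfs
  have hL : ∀ j, (L j).IsHomogeneous (Multiset.card (fs j)) := fun j =>
    hprod j ▸ isHomogeneous_multiset_prod (fs j) (hhom j)
  obtain ⟨h, -, -, ⟨c, hc⟩, hh⟩ := exists_hilbert_normalizedMatching (K := K) Finset.univ
    (fun j => Multiset.card (fs j)) (fun j hj => absurd (Finset.mem_univ j) hj)
  obtain ⟨hhilb, hNM⟩ := hh L (isRegularFamily_of_isRegular (fun j => ⟨_, hcard j, hL j⟩) hreg)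
    fun j => ⟨fs j, rfl, hhom j, hprod j⟩
  have hb : ComponentClosed (Ideal.span (Set.range L)) :=
    componentClosed_span (by rintro _ ⟨j, rfl⟩; exact ⟨_, hL j⟩)
  have hpiece : ∀ i : ℕ, finrank K (gradedPiece (Ideal.span (Set.range L)) i) = h i := fun i =>
    hhilb i
  have hpow : idealOfVars (Fin n) K ^ c.toNat ≤ Ideal.span (Set.range L) :=
    pow_idealOfVars_le_of_quotDim_eq_zero ((hhilb c.toNat).trans (hc _ (Int.self_le_toNat c)))
  obtain ⟨i₀, -, hi₀⟩ := Finset.exists_max_image (Finset.range (c.toNat + 1)) (fun i => h i)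
    ⟨0, by simp⟩
  have hmax : ∀ i : ℕ, h i ≤ h i₀ := by
    intro i
    by_cases hi : i < c.toNat
    · exact hi₀ i (Finset.mem_range.2 (by omega))
    · rw [hc i (by omega)]
      exact Nat.zero_le _
  refine ⟨i₀, fun i => by rw [hpiece, hpiece]; exact hmax i,
    ⟨_, nu_pow_gradedMaxIdeal hb hpow i₀⟩, ?_⟩
  rintro _ ⟨I, rfl⟩
  rw [hpiece]
  exact nu_le_of_normalizedMatching hb hhilb hNM hpow hmax I
end
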